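/- Fix θ > 0 and real numbers x_1, …, x_r in [0,1]. For each N let σ_N be an Ewens(θ)-distributed random permutation of S_N, and set Z^{(N)}(x) = √N ( F^{(N)}_{σ_N}(x) − E[F^{(N)}_{σ_N}(x)] ). Then the random vector (Z^{(N)}(x_1), …, Z^{(N)}(x_r)) converges in distribution, as N → ∞, to a centered Gaussian vector (G(x_1), …, G(x_r)) with covariance matrix (K(x_i, x_j))_{1 ≤ i,j ≤ r}, where K(x,y) = ∫_0^{min(x,y)} t(1−t) dt − ∫_0^x ∫_0^y min(t,u)(1 − max(t,u)) du dt. -/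

import Mathlib

open scoped BigOperators Classical
open Finset

noncomputable section

/-- Total number of cycles of a permutation of `Fin N`, fixed points included. -/
def cycleCount {N : ℕ} (σ : Equiv.Perm (Fin N)) : ℕ :=
  Multiset.card σ.cycleType + (N - σ.cycleType.sum)

/-- Expectation of `f` under the Ewens measure with parameter `θ` on `S_N`. -/
def ewensE (θ : ℝ) (N : ℕ) (f : Equiv.Perm (Fin N) → ℝ) : ℝ :=
  (∑ σ : Equiv.Perm (Fin N), θ ^ cycleCount σ * f σ) / ∏ k ∈ Finset.range N, (θ + (k : ℝ))

/-- Probability of an event under the Ewens measure. -/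
def ewensP (θ : ℝ) (N : ℕ) (A : Set (Equiv.Perm (Fin N))) : ℝ :=
  ewensE θ N (fun σ => if σ ∈ A then 1 else 0)

/-- The Bernoulli random variable `B^{(N)}_{i,s}`, equal to 1 iff `σ i = s`. -/
def Bis {N : ℕ} (i s : Fin N) (σ : Equiv.Perm (Fin N)) : ℝ :=
  if σ i = s then 1 else 0

/-- The set partitions of a finset `S`, encoded as finsets of nonempty disjoint finsets
covering `S`. -/
def partitionsOf {ι : Type*} [DecidableEq ι] (S : Finset ι) : Finset (Finset (Finset ι)) :=
  S.powerset.powerset.filter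
    (fun P => (∀ C ∈ P, C.Nonempty) ∧ ∀ j ∈ S, ∃! C, C ∈ P ∧ j ∈ C)

/-- The joint cumulant of the family of random variables indexed by `S`, expressed through
the moments function `M` : `κ = Σ_π (−1)^{#π−1} (#π−1)! Π_{C ∈ π} M C`. -/
def cumulantOn {ι 𝕜 : Type*} [DecidableEq ι] [Field 𝕜] (S : Finset ι) (M : Finset ι → 𝕜) : 𝕜 :=
  ∑ P ∈ partitionsOf S,
    (-1 : 𝕜) ^ (P.card - 1) * ((P.card - 1).factorial : 𝕜) * ∏ C ∈ P, M C


/-- Number of weak exceedances among the first `k` positions (1-indexed positions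
`1,…,k` correspond to `i : Fin N` with `(i:ℕ) < k`). -/
def countExc {N : ℕ} (σ : Equiv.Perm (Fin N)) (k : ℕ) : ℕ :=
  (Finset.univ.filter (fun i : Fin N => (i : ℕ) < k ∧ (i : ℕ) ≤ (σ i : ℕ))).card

/-- The function `F^{(N)}_σ : [0,1] → ℝ`: equal to `(1/N) Σ_{i=1}^{Nx} B^{ex,N}_i(σ)` when
`Nx` is an integer, and affine on each interval `[i/N,(i+1)/N]`. -/
def Fex {N : ℕ} (σ : Equiv.Perm (Fin N)) (x : ℝ) : ℝ :=
  ((countExc σ ⌊(N : ℝ) * x⌋₊ : ℝ)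
    + ((N : ℝ) * x - (⌊(N : ℝ) * x⌋₊ : ℝ)) *
        ((countExc σ (⌊(N : ℝ) * x⌋₊ + 1) : ℝ) - (countExc σ ⌊(N : ℝ) * x⌋₊ : ℝ))) / N

/-- The covariance function `K(x,y)` of the limiting Gaussian process. -/
def Kcov (x y : ℝ) : ℝ :=
  (∫ t in (0:ℝ)..(min x y), t * (1 - t)) -
    ∫ t in (0:ℝ)..x, ∫ u in (0:ℝ)..y, min t u * (1 - max t u)

open Equiv Equiv.Perm in
theorem card_quotient_sameCycle {N : ℕ} (σ : Equiv.Perm (Fin N)) :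
    Fintype.card (Quotient (SameCycle.setoid σ)) = cycleCount σ := by
  have hs : σ.cycleType.sum = σ.support.card := σ.sum_cycleType
  have hc : Multiset.card σ.cycleType = σ.cycleFactorsFinset.card := by
    simp [cycleType_def]
  have hcompl : N - σ.support.card = σ.supportᶜ.card := by
    rw [Finset.card_compl, Fintype.card_fin]
  have hout : ∀ x, SameCycle σ (Quotient.mk (SameCycle.setoid σ) x).out x :=
    fun x => Quotient.exact (Quotient.out_eq (Quotient.mk (SameCycle.setoid σ) x))
  rw [cycleCount, hs, hc, hcompl, ← Finset.card_univ,
    ← Finset.card_filter_add_card_filter_not (fun q : Quotient (SameCycle.setoid σ) =>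
      q.out ∈ σ.support)]
  congr 1
  · refine Finset.card_bij (fun q _ => σ.cycleOf q.out) ?_ ?_ ?_
    · intro q hq
      exact cycleOf_mem_cycleFactorsFinset_iff.2 (Finset.mem_filter.1 hq).2
    · intro q hq q' hq' h
      rw [← Quotient.out_eq q, ← Quotient.out_eq q']
      exact Quotient.sound
        ((sameCycle_iff_cycleOf_eq_of_mem_support (Finset.mem_filter.1 hq).2
          (Finset.mem_filter.1 hq').2).2 h)
    · intro c hc
      obtain ⟨hcyc, hcσ⟩ := mem_cycleFactorsFinset_iff.1 hc
      obtain ⟨x, hx, -⟩ := id hcyc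
      have hxs : x ∈ c.support := mem_support.2 hx
      have hce : c = σ.cycleOf x := cycle_is_cycleOf hxs hc
      have hxσ : x ∈ σ.support := mem_cycleFactorsFinset_support_le hc hxs
      refine ⟨Quotient.mk _ x, ?_, ?_⟩
      · simp only [Finset.mem_filter, Finset.mem_univ, true_and]
        rw [mem_support]
        exact fun h => mem_support.1 hxσ ((hout x).apply_eq_self_iff.1 h)
      · exact (hout x).cycleOf_eq.trans hce.symm
  · refine Finset.card_bij (fun q _ => q.out) ?_ ?_ ?_
    · intro q hq
      exact Finset.mem_compl.2 (Finset.mem_filter.1 hq).2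
    · intro q _ q' _ h
      exact Quotient.out_injective h
    · intro x hx
      have hx' : σ x = x := notMem_support.1 (Finset.mem_compl.1 hx)
      have hxo : (Quotient.mk (SameCycle.setoid σ) x).out = x := by
        obtain ⟨k, hk⟩ := (hout x).symm
        rw [← hk, zpow_apply_eq_self_of_apply_eq_self hx']
      exact ⟨Quotient.mk _ x, by simpa [hxo] using hx', hxo⟩

/-- Two permutations related by a retraction that sends each step to at most one step have the
same number of cycles. -/
theorem cycleCount_eq_of_retraction {m n : ℕ} {σ : Equiv.Perm (Fin m)} {τ : Equiv.Perm (Fin n)}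
    (ι : Fin m → Fin n) (p : Fin n → Fin m) (hp : ∀ a, p (ι a) = a)
    (hstep : ∀ b, p (τ b) = p b ∨ p (τ b) = σ (p b))
    (hι : ∀ a, τ.SameCycle (ι a) (ι (σ a))) (hιp : ∀ b, τ.SameCycle b (ι (p b))) :
    cycleCount τ = cycleCount σ := by
  have h1 : ∀ (k : ℕ) b, σ.SameCycle (p b) (p ((τ ^ k) b)) := by
    intro k b
    induction k with
    | zero => exact Equiv.Perm.SameCycle.refl _ _
    | succ k ih =>
      refine ih.trans ?_
      rw [pow_succ', Equiv.Perm.mul_apply]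
      rcases hstep ((τ ^ k) b) with h | h
      · rw [h]
      · rw [h]
        exact Equiv.Perm.sameCycle_apply_right.2 (Equiv.Perm.SameCycle.refl _ _)
  have h2 : ∀ (k : ℕ) a, τ.SameCycle (ι a) (ι ((σ ^ k) a)) := by
    intro k a
    induction k with
    | zero => exact Equiv.Perm.SameCycle.refl _ _
    | succ k ih =>
      rw [pow_succ', Equiv.Perm.mul_apply]
      exact ih.trans (hι _)
  rw [← card_quotient_sameCycle, ← card_quotient_sameCycle]
  refine Fintype.card_congr
    { toFun := Quotient.map' p ?_
      invFun := Quotient.map' ι ?_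
      left_inv := ?_
      right_inv := ?_ }
  · intro b b' h
    obtain ⟨k, -, -, hk⟩ := Equiv.Perm.SameCycle.exists_pow_eq τ h
    exact hk ▸ h1 k b
  · intro a a' h
    obtain ⟨k, -, -, hk⟩ := Equiv.Perm.SameCycle.exists_pow_eq σ h
    exact hk ▸ h2 k a
  · intro q
    induction q using Quotient.inductionOn' with
    | h b => exact Quotient.sound' (hιp b).symm
  · intro q
    induction q using Quotient.inductionOn' with
    | h a => simp [hp]

/-- Extension of a permutation of `Fin n` to `Fin (n + 1)` fixing the last point. -/
def extendLast {n : ℕ} (σ : Equiv.Perm (Fin n)) : Equiv.Perm (Fin (n + 1)) :=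
  σ.viaFintypeEmbedding Fin.castSuccEmb

@[simp]
theorem extendLast_castSucc {n : ℕ} (σ : Equiv.Perm (Fin n)) (i : Fin n) :
    extendLast σ i.castSucc = (σ i).castSucc :=
  σ.viaFintypeEmbedding_apply_image Fin.castSuccEmb i

@[simp]
theorem extendLast_last {n : ℕ} (σ : Equiv.Perm (Fin n)) :
    extendLast σ (Fin.last n) = Fin.last n := by
  refine σ.viaFintypeEmbedding_apply_notMem_range _ ?_
  rintro ⟨i, hi⟩
  exact (Fin.castSucc_lt_last i).ne hi

theorem cycleCount_extendLast {n : ℕ} (σ : Equiv.Perm (Fin n)) :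
    cycleCount (extendLast σ) = cycleCount σ + 1 := by
  have h : (extendLast σ).cycleType = σ.cycleType := by
    unfold extendLast Equiv.Perm.viaFintypeEmbedding
    convert Equiv.Perm.cycleType_extendDomain _ using 1
  have hle : σ.cycleType.sum ≤ n := by
    rw [σ.sum_cycleType]
    simpa using Finset.card_le_univ σ.support
  rw [cycleCount, cycleCount, h]
  omega

/-- Insertion of the last point right after `j` in its cycle. -/
def insertLast {n : ℕ} (σ : Equiv.Perm (Fin n)) (j : Fin n) : Equiv.Perm (Fin (n + 1)) :=
  extendLast σ * Equiv.swap j.castSucc (Fin.last n)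

@[simp]
theorem insertLast_last {n : ℕ} (σ : Equiv.Perm (Fin n)) (j : Fin n) :
    insertLast σ j (Fin.last n) = (σ j).castSucc := by
  simp [insertLast]

@[simp]
theorem insertLast_self {n : ℕ} (σ : Equiv.Perm (Fin n)) (j : Fin n) :
    insertLast σ j j.castSucc = Fin.last n := by
  simp [insertLast]

theorem insertLast_of_ne {n : ℕ} (σ : Equiv.Perm (Fin n)) {i j : Fin n} (h : i ≠ j) :
    insertLast σ j i.castSucc = (σ i).castSucc := by
  rw [insertLast, Equiv.Perm.mul_apply, Equiv.swap_apply_of_ne_of_ne, extendLast_castSucc]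
  · simpa using h
  · exact (Fin.castSucc_lt_last i).ne

theorem cycleCount_insertLast {n : ℕ} (σ : Equiv.Perm (Fin n)) (j : Fin n) :
    cycleCount (insertLast σ j) = cycleCount σ := by
  have hjl : (insertLast σ j).SameCycle j.castSucc (Fin.last n) :=
    ⟨1, by simp⟩
  refine cycleCount_eq_of_retraction Fin.castSucc
    (fun b => Fin.lastCases j (fun i => i) b) (fun a => by simp) ?_ ?_ ?_
  · intro b
    induction b using Fin.lastCases with
    | last => right; simp
    | cast i =>
      by_cases h : i = j
      · left; subst h; simp
      · right; simp [insertLast_of_ne σ h]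
  · intro a
    by_cases h : a = j
    · subst h
      exact hjl.trans ⟨1, by simp⟩
    · exact ⟨1, by simp [insertLast_of_ne σ h]⟩
  · intro b
    induction b using Fin.lastCases with
    | last => simpa using hjl.symm
    | cast i => simp [Equiv.Perm.SameCycle.refl]

theorem sum_perm_fin_succ {n : ℕ} {E : Type*} [AddCommMonoid E]
    (F : Equiv.Perm (Fin (n + 1)) → E) :
    ∑ τ, F τ = ∑ σ : Equiv.Perm (Fin n), (∑ j, F (insertLast σ j) + F (extendLast σ)) := by
  have hinj : Function.Injective (fun q : Equiv.Perm (Fin n) × Fin (n + 1) =>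
      extendLast q.1 * Equiv.swap q.2 (Fin.last n)) := by
    rintro ⟨σ, a⟩ ⟨σ', a'⟩ h
    have ha : a = a' := by
      have h1 : (extendLast σ * Equiv.swap a (Fin.last n)) a = Fin.last n := by simp
      have h2 : (extendLast σ' * Equiv.swap a' (Fin.last n)) a' = Fin.last n := by simp
      have h3 : (extendLast σ' * Equiv.swap a' (Fin.last n)) a = Fin.last n := by
        exact (DFunLike.congr_fun h a).symm.trans h1
      exact (extendLast σ' * Equiv.swap a' (Fin.last n)).injective (h3.trans h2.symm)
    subst ha
    have hσ : extendLast σ = extendLast σ' := mul_right_cancel h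
    refine Prod.ext (Equiv.ext fun i => Fin.castSucc_injective n ?_) rfl
    rw [← extendLast_castSucc, ← extendLast_castSucc, hσ]
  have hbij := (Fintype.bijective_iff_injective_and_card _).2
    ⟨hinj, by simp [Fintype.card_perm, Nat.factorial_succ, mul_comm]⟩
  rw [← hbij.sum_comp, Fintype.sum_prod_type]
  refine Finset.sum_congr rfl fun σ _ => ?_
  rw [Fin.sum_univ_castSucc]
  congr 1
  simp only [Equiv.swap_self]
  rfl

/-- The Ewens probability of a single permutation. -/
def ewensWeight (θ : ℝ) {n : ℕ} (σ : Equiv.Perm (Fin n)) : ℝ :=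
  θ ^ cycleCount σ / ∏ k ∈ Finset.range n, (θ + (k : ℝ))

/-- The Ewens average of a vector-valued function. -/
def ewensAvg {E : Type*} [AddCommGroup E] [Module ℝ E] (θ : ℝ) (n : ℕ)
    (F : Equiv.Perm (Fin n) → E) : E :=
  ∑ σ, ewensWeight θ σ • F σ

theorem ewensE_eq_ewensAvg (θ : ℝ) (n : ℕ) (F : Equiv.Perm (Fin n) → ℝ) :
    ewensE θ n F = ewensAvg θ n F := by
  simp only [ewensE, ewensAvg, ewensWeight, Finset.sum_div, smul_eq_mul]
  exact Finset.sum_congr rfl fun σ _ => by ring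

theorem ewensWeight_nonneg {θ : ℝ} (hθ : 0 < θ) {n : ℕ} (σ : Equiv.Perm (Fin n)) :
    0 ≤ ewensWeight θ σ :=
  div_nonneg (pow_nonneg hθ.le _) (Finset.prod_nonneg fun k _ => by positivity)

theorem ewensAvg_succ {E : Type*} [AddCommGroup E] [Module ℝ E] {θ : ℝ} (hθ : 0 < θ) (n : ℕ)
    (F : Equiv.Perm (Fin (n + 1)) → E) :
    ewensAvg θ (n + 1) F = ewensAvg θ n
      (fun σ => (θ + n)⁻¹ • (∑ j, F (insertLast σ j) + θ • F (extendLast σ))) := by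
  have hn : θ + n ≠ 0 := by positivity
  have hins : ∀ (σ : Equiv.Perm (Fin n)) j,
      ewensWeight θ (insertLast σ j) = ewensWeight θ σ * (θ + n)⁻¹ := by
    intro σ j
    rw [ewensWeight, ewensWeight, cycleCount_insertLast, Finset.prod_range_succ, div_mul_eq_div_div,
      div_eq_mul_inv _ (θ + (n : ℝ))]
  have hext : ∀ σ : Equiv.Perm (Fin n),
      ewensWeight θ (extendLast σ) = ewensWeight θ σ * (θ + n)⁻¹ * θ := by
    intro σ
    rw [ewensWeight, ewensWeight, cycleCount_extendLast, Finset.prod_range_succ, div_mul_eq_div_div,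
      div_eq_mul_inv _ (θ + (n : ℝ)), pow_succ]
    ring
  rw [ewensAvg, sum_perm_fin_succ]
  refine Finset.sum_congr rfl fun σ _ => ?_
  simp only [hins, hext, smul_add, smul_smul, Finset.smul_sum, mul_assoc]

theorem ewensAvg_zero_fin {E : Type*} [AddCommGroup E] [Module ℝ E] (θ : ℝ)
    (F : Equiv.Perm (Fin 0) → E) : ewensAvg θ 0 F = F 1 := by
  have h : ewensWeight θ (1 : Equiv.Perm (Fin 0)) = 1 := by
    simp [ewensWeight, cycleCount]
  rw [ewensAvg, Fintype.sum_unique]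
  rw [Subsingleton.elim (default : Equiv.Perm (Fin 0)) 1, h, one_smul]

theorem sum_ewensWeight {θ : ℝ} (hθ : 0 < θ) (n : ℕ) :
    ∑ σ : Equiv.Perm (Fin n), ewensWeight θ σ = 1 := by
  have h : ∀ n : ℕ, ewensAvg θ n (fun _ => (1 : ℝ)) = 1 := by
    intro n
    induction n with
    | zero => exact ewensAvg_zero_fin θ _
    | succ n ih =>
      have hn : θ + n ≠ 0 := by positivity
      rw [ewensAvg_succ hθ]
      convert ih using 2
      funext σ
      simp only [Finset.sum_const, Finset.card_univ, Fintype.card_fin, nsmul_eq_mul, mul_one,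
        smul_eq_mul]
      rw [add_comm (n : ℝ), inv_mul_cancel₀ hn]
  simpa [ewensAvg] using h n

theorem ewensAvg_const {E : Type*} [AddCommGroup E] [Module ℝ E] {θ : ℝ} (hθ : 0 < θ) (n : ℕ)
    (c : E) : ewensAvg θ n (fun _ => c) = c := by
  rw [ewensAvg, ← Finset.sum_smul, sum_ewensWeight hθ, one_smul]

theorem ewensAvg_add {E : Type*} [AddCommGroup E] [Module ℝ E] (θ : ℝ) (n : ℕ)
    (F G : Equiv.Perm (Fin n) → E) :
    ewensAvg θ n (fun σ => F σ + G σ) = ewensAvg θ n F + ewensAvg θ n G := by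
  simp [ewensAvg, Finset.sum_add_distrib]

theorem ewensAvg_sub {E : Type*} [AddCommGroup E] [Module ℝ E] (θ : ℝ) (n : ℕ)
    (F G : Equiv.Perm (Fin n) → E) :
    ewensAvg θ n (fun σ => F σ - G σ) = ewensAvg θ n F - ewensAvg θ n G := by
  simp [ewensAvg, smul_sub]

theorem ewensAvg_const_mul {E : Type*} [Ring E] [Algebra ℝ E] (θ : ℝ) (n : ℕ) (c : E)
    (F : Equiv.Perm (Fin n) → E) :
    ewensAvg θ n (fun σ => c * F σ) = c * ewensAvg θ n F := by
  simp [ewensAvg, Finset.mul_sum]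

theorem ewensAvg_mono {θ : ℝ} (hθ : 0 < θ) {n : ℕ} {F G : Equiv.Perm (Fin n) → ℝ}
    (h : ∀ σ, F σ ≤ G σ) : ewensAvg θ n F ≤ ewensAvg θ n G :=
  Finset.sum_le_sum fun σ _ => mul_le_mul_of_nonneg_left (h σ) (ewensWeight_nonneg hθ σ)

theorem norm_ewensAvg_le {E : Type*} [NormedAddCommGroup E] [NormedSpace ℝ E] {θ : ℝ}
    (hθ : 0 < θ) {n : ℕ} (F : Equiv.Perm (Fin n) → E) :
    ‖ewensAvg θ n F‖ ≤ ewensAvg θ n (fun σ => ‖F σ‖) := by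
  refine (norm_sum_le _ _).trans (Finset.sum_le_sum fun σ _ => ?_)
  rw [norm_smul, Real.norm_of_nonneg (ewensWeight_nonneg hθ σ), smul_eq_mul]

/-- The sum of `f` over the indices that are not weak exceedances. -/
def deficSum (f : ℕ → ℝ) {n : ℕ} (σ : Equiv.Perm (Fin n)) : ℝ :=
  ∑ i : Fin n, if σ i < i then f i else 0

/-- The sum of `i * f i` over `i < n`. -/
def firstMoment (f : ℕ → ℝ) (n : ℕ) : ℝ := ∑ i ∈ Finset.range n, (i : ℝ) * f i

theorem deficSum_extendLast (f : ℕ → ℝ) {n : ℕ} (σ : Equiv.Perm (Fin n)) :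
    deficSum f (extendLast σ) = deficSum f σ := by
  simp [deficSum, Fin.sum_univ_castSucc]

theorem deficSum_insertLast (f : ℕ → ℝ) {n : ℕ} (σ : Equiv.Perm (Fin n)) (j : Fin n) :
    deficSum f (insertLast σ j) = deficSum f σ - (if σ j < j then f j else 0) + f n := by
  have h : ∀ i : Fin n, (if insertLast σ j i.castSucc < i.castSucc then f i else 0) =
      (if σ i < i then f i else 0) - if i = j then (if σ j < j then f j else 0) else 0 := by
    intro i
    by_cases hij : i = j
    · subst hij
      simp [(Fin.castSucc_lt_last i).not_gt]
    · simp [insertLast_of_ne σ hij, hij]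
  rw [deficSum, Fin.sum_univ_castSucc]
  simp only [Fin.val_castSucc, Fin.val_last, insertLast_last, Fin.castSucc_lt_last, if_true, h,
    Finset.sum_sub_distrib, Finset.sum_ite_eq', Finset.mem_univ]
  rfl

theorem abs_deficSum_le {f : ℕ → ℝ} {T : ℝ} (hf : ∀ i, |f i| ≤ T) {n : ℕ}
    (σ : Equiv.Perm (Fin n)) : |deficSum f σ| ≤ n * T := by
  have hT : 0 ≤ T := (abs_nonneg _).trans (hf 0)
  refine (Finset.abs_sum_le_sum_abs _ _).trans ?_
  refine (Finset.sum_le_card_nsmul _ _ T fun i _ => ?_).trans (by simp)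
  split_ifs
  · exact hf i
  · simpa using hT

/-- The centered and rescaled `deficSum`, a martingale along the insertion process. -/
def deficMart (θ : ℝ) (f : ℕ → ℝ) {n : ℕ} (σ : Equiv.Perm (Fin n)) : ℝ :=
  (θ + n - 1) * deficSum f σ - firstMoment f n

/-- Increment of `deficMart` when the last point is inserted after `j`. -/
def insertIncr (θ : ℝ) (f : ℕ → ℝ) {n : ℕ} (σ : Equiv.Perm (Fin n)) (j : Fin n) : ℝ :=
  deficSum f σ - n * f n + (θ + n) * (f n - if σ j < j then f j else 0)

/-- Increment of `deficMart` when the last point is added as a fixed point. -/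
def extendIncr (f : ℕ → ℝ) {n : ℕ} (σ : Equiv.Perm (Fin n)) : ℝ :=
  deficSum f σ - n * f n

/-- Conditional second moment of the increments of `deficMart`. -/
def condVar (θ : ℝ) (f : ℕ → ℝ) {n : ℕ} (σ : Equiv.Perm (Fin n)) : ℝ :=
  n * deficSum (fun i => f i ^ 2) σ - deficSum f σ ^ 2 +
    θ * (n * f n ^ 2 - 2 * f n * deficSum f σ + deficSum (fun i => f i ^ 2) σ)

theorem deficMart_insertLast (θ : ℝ) (f : ℕ → ℝ) {n : ℕ} (σ : Equiv.Perm (Fin n)) (j : Fin n) :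
    deficMart θ f (insertLast σ j) = deficMart θ f σ + insertIncr θ f σ j := by
  simp only [deficMart, insertIncr, deficSum_insertLast, firstMoment, Finset.sum_range_succ]
  push_cast
  ring

theorem deficMart_extendLast (θ : ℝ) (f : ℕ → ℝ) {n : ℕ} (σ : Equiv.Perm (Fin n)) :
    deficMart θ f (extendLast σ) = deficMart θ f σ + extendIncr f σ := by
  simp only [deficMart, extendIncr, deficSum_extendLast, firstMoment, Finset.sum_range_succ]
  push_cast
  ring

theorem sum_insertIncr (θ : ℝ) (f : ℕ → ℝ) {n : ℕ} (σ : Equiv.Perm (Fin n)) :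
    ∑ j, insertIncr θ f σ j + θ * extendIncr f σ = 0 := by
  simp only [insertIncr, extendIncr, Finset.sum_add_distrib, ← Finset.mul_sum,
    Finset.sum_sub_distrib, Finset.sum_const, Finset.card_univ, Fintype.card_fin, nsmul_eq_mul]
  rw [← deficSum]
  ring

theorem sum_insertIncr_sq (θ : ℝ) (f : ℕ → ℝ) {n : ℕ} (σ : Equiv.Perm (Fin n)) :
    ∑ j, insertIncr θ f σ j ^ 2 + θ * extendIncr f σ ^ 2 = (θ + n) * condVar θ f σ := by
  have h : ∀ j : Fin n, insertIncr θ f σ j ^ 2 =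
      extendIncr f σ ^ 2 + 2 * extendIncr f σ * (θ + n) * f n + (θ + n) ^ 2 * f n ^ 2
      - (2 * extendIncr f σ * (θ + n) + 2 * (θ + n) ^ 2 * f n) * (if σ j < j then f j else 0)
      + (θ + n) ^ 2 * (if σ j < j then f j ^ 2 else 0) := by
    intro j
    simp only [insertIncr, extendIncr]
    split_ifs <;> ring
  simp only [h, Finset.sum_add_distrib, Finset.sum_sub_distrib, ← Finset.mul_sum,
    Finset.sum_const, Finset.card_univ, Fintype.card_fin, nsmul_eq_mul]
  have h2 : (∑ j : Fin n, if σ j < j then f j ^ 2 else 0) = deficSum (fun i => f i ^ 2) σ := rfl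
  rw [← deficSum, h2, condVar, extendIncr]
  ring

theorem abs_extendIncr_le {f : ℕ → ℝ} {T : ℝ} (hf : ∀ i, |f i| ≤ T) {θ : ℝ} (hθ : 0 < θ) {n : ℕ}
    (σ : Equiv.Perm (Fin n)) : |extendIncr f σ| ≤ 4 * T * (θ + n) := by
  have hT : 0 ≤ T := (abs_nonneg _).trans (hf 0)
  have h1 := abs_deficSum_le hf σ
  have h2 : |(n : ℝ) * f n| ≤ n * T := by
    rw [abs_mul, Nat.abs_cast]
    exact mul_le_mul_of_nonneg_left (hf n) (Nat.cast_nonneg n)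
  have h3 := abs_sub (deficSum f σ) (n * f n)
  have h4 : 0 ≤ n * T := by positivity
  have h5 : 0 ≤ T * θ := by positivity
  rw [extendIncr]
  nlinarith

theorem abs_insertIncr_le {f : ℕ → ℝ} {T : ℝ} (hf : ∀ i, |f i| ≤ T) {θ : ℝ} (hθ : 0 < θ) {n : ℕ}
    (σ : Equiv.Perm (Fin n)) (j : Fin n) : |insertIncr θ f σ j| ≤ 4 * T * (θ + n) := by
  have hT : 0 ≤ T := (abs_nonneg _).trans (hf 0)
  have h1 := abs_deficSum_le hf σ
  have h2 : |(n : ℝ) * f n| ≤ n * T := by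
    rw [abs_mul, Nat.abs_cast]
    exact mul_le_mul_of_nonneg_left (hf n) (Nat.cast_nonneg n)
  have h3 := abs_sub (deficSum f σ) (n * f n)
  have h4 : 0 ≤ n * T := by positivity
  have h5 : 0 ≤ T * θ := by positivity
  have h6 : |f n - if σ j < j then f j else 0| ≤ 2 * T := by
    split_ifs
    · have := abs_sub (f n) (f j)
      linarith [hf n, hf j]
    · rw [sub_zero]
      linarith [hf n]
  have h7 : |(θ + n) * (f n - if σ j < j then f j else 0)| ≤ (θ + n) * (2 * T) := by
    rw [abs_mul, abs_of_pos (by positivity : 0 < θ + n)]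
    exact mul_le_mul_of_nonneg_left h6 (by positivity)
  have h8 := abs_add_le (deficSum f σ - n * f n) ((θ + n) * (f n - if σ j < j then f j else 0))
  rw [insertIncr]
  nlinarith

theorem ewensAvg_deficMart {θ : ℝ} (hθ : 0 < θ) (f : ℕ → ℝ) (n : ℕ) :
    ewensAvg θ n (fun σ => deficMart θ f σ) = 0 := by
  induction n with
  | zero => rw [ewensAvg_zero_fin]; simp [deficMart, deficSum, firstMoment]
  | succ n ih =>
    have hn : θ + n ≠ 0 := by positivity
    rw [ewensAvg_succ hθ, ← ih]
    congr 1
    funext σ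
    simp only [deficMart_insertLast, deficMart_extendLast, Finset.sum_add_distrib,
      Finset.sum_const, Finset.card_univ, Fintype.card_fin, nsmul_eq_mul, smul_eq_mul]
    rw [inv_mul_eq_iff_eq_mul₀ hn]
    linear_combination sum_insertIncr θ f σ

theorem ewensAvg_deficMart_sq_succ {θ : ℝ} (hθ : 0 < θ) (f : ℕ → ℝ) (n : ℕ) :
    ewensAvg θ (n + 1) (fun σ => deficMart θ f σ ^ 2) =
      ewensAvg θ n (fun σ => deficMart θ f σ ^ 2 + condVar θ f σ) := by
  have hn : θ + n ≠ 0 := by positivity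
  rw [ewensAvg_succ hθ]
  congr 1
  funext σ
  simp only [deficMart_insertLast, deficMart_extendLast, add_sq, Finset.sum_add_distrib,
    ← Finset.mul_sum, Finset.sum_const, Finset.card_univ, Fintype.card_fin, nsmul_eq_mul,
    smul_eq_mul]
  rw [inv_mul_eq_iff_eq_mul₀ hn]
  linear_combination 2 * deficMart θ f σ * sum_insertIncr θ f σ + sum_insertIncr_sq θ f σ

theorem condVar_le {f : ℕ → ℝ} {T : ℝ} (hf : ∀ i, |f i| ≤ T) {θ : ℝ} (hθ : 0 < θ) {n : ℕ}
    (σ : Equiv.Perm (Fin n)) : condVar θ f σ ≤ (1 + 4 * θ) * T ^ 2 * n ^ 2 := by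
  have hf2 : ∀ i, |f i ^ 2| ≤ T ^ 2 := fun i => by
    rw [abs_pow]; exact pow_le_pow_left₀ (abs_nonneg _) (hf i) 2
  have h1 := (abs_le.1 (abs_deficSum_le hf2 σ)).2
  have h2 : |f n * deficSum f σ| ≤ T * (n * T) := by
    rw [abs_mul]
    exact mul_le_mul (hf n) (abs_deficSum_le hf σ) (abs_nonneg _) ((abs_nonneg _).trans (hf 0))
  have h3 := (abs_le.1 h2).1
  have h4 := (abs_le.1 (hf2 n)).2
  have hn : (n : ℝ) ≤ n ^ 2 := by exact_mod_cast Nat.le_self_pow two_ne_zero n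
  have h5 : (n : ℝ) * f n ^ 2 - 2 * f n * deficSum f σ + deficSum (fun i => f i ^ 2) σ
      ≤ 4 * T ^ 2 * n ^ 2 := by
    have : (n : ℝ) * f n ^ 2 ≤ n * T ^ 2 := mul_le_mul_of_nonneg_left h4 (Nat.cast_nonneg n)
    have : T ^ 2 * (n : ℝ) ≤ T ^ 2 * n ^ 2 := mul_le_mul_of_nonneg_left hn (sq_nonneg T)
    nlinarith
  have h6 := mul_le_mul_of_nonneg_left h5 hθ.le
  have h7 := mul_le_mul_of_nonneg_left h1 (Nat.cast_nonneg (α := ℝ) n)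
  rw [condVar]
  nlinarith [sq_nonneg (deficSum f σ)]

theorem ewensAvg_deficMart_sq_le {f : ℕ → ℝ} {T : ℝ} (hf : ∀ i, |f i| ≤ T) {θ : ℝ} (hθ : 0 < θ)
    (n : ℕ) : ewensAvg θ n (fun σ => deficMart θ f σ ^ 2) ≤ (1 + 4 * θ) * T ^ 2 * n ^ 3 := by
  induction n with
  | zero => rw [ewensAvg_zero_fin]; simp [deficMart, deficSum, firstMoment]
  | succ n ih =>
    have h : ewensAvg θ n (fun σ => condVar θ f σ) ≤ (1 + 4 * θ) * T ^ 2 * n ^ 2 :=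
      (ewensAvg_mono hθ fun σ => condVar_le hf hθ σ).trans (ewensAvg_const hθ n _).le
    rw [ewensAvg_deficMart_sq_succ hθ, ewensAvg_add]
    refine (add_le_add ih h).trans ?_
    rw [← mul_add]
    refine mul_le_mul_of_nonneg_left ?_ (by positivity)
    have : (0 : ℝ) ≤ n := Nat.cast_nonneg n
    push_cast
    nlinarith [sq_nonneg (n : ℝ)]

theorem abs_firstMoment_le {f : ℕ → ℝ} {T : ℝ} (hf : ∀ i, |f i| ≤ T) (n : ℕ) :
    |firstMoment f n| ≤ T * n ^ 2 := by
  refine (Finset.abs_sum_le_sum_abs _ _).trans ?_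
  refine (Finset.sum_le_card_nsmul _ _ (n * T) fun i hi => ?_).trans ?_
  · rw [abs_mul, Nat.abs_cast]
    exact mul_le_mul (by exact_mod_cast (Finset.mem_range.1 hi).le) (hf i) (abs_nonneg _)
      (Nat.cast_nonneg n)
  · simp only [Finset.card_range, nsmul_eq_mul]
    exact le_of_eq (by ring)

/-- The constant in the bound on the mean deviation of `deficSum`. -/
def devConst (θ T : ℝ) : ℝ := ((1 + 4 * θ) * T ^ 2 + 1 + (θ + 1) * T) / min 1 θ

theorem ewensAvg_abs_deficSum_sub_le {f : ℕ → ℝ} {T : ℝ} (hf : ∀ i, |f i| ≤ T) {θ : ℝ}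
    (hθ : 0 < θ) {n : ℕ} (hn : 1 ≤ n) :
    ewensAvg θ n (fun σ => |deficSum f σ - firstMoment f n / n|) ≤ devConst θ T * √n := by
  have hn1 : (1 : ℝ) ≤ n := by exact_mod_cast hn
  have hn0 : (0 : ℝ) < n := by linarith
  have hT : 0 ≤ T := (abs_nonneg _).trans (hf 0)
  set c : ℝ := min 1 θ with hc
  have hc0 : 0 < c := lt_min one_pos hθ
  have hcn : c * n ≤ θ + n - 1 := by
    rcases le_total 1 θ with h | h
    · rw [hc, min_eq_left h]; linarith
    · rw [hc, min_eq_right h]; nlinarith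
  have hpos : 0 < θ + n - 1 := lt_of_lt_of_le (by positivity) hcn
  set r : ℝ := √n with hr
  have hr2 : r ^ 2 = n := Real.sq_sqrt hn0.le
  have hr1 : 1 ≤ r := Real.one_le_sqrt.2 hn1
  have hr0 : 0 < r := by linarith
  have hpt : ∀ σ : Equiv.Perm (Fin n), |deficSum f σ - firstMoment f n / n| ≤
      (2 * c * r ^ 5)⁻¹ * deficMart θ f σ ^ 2 + (r / (2 * c) + (θ + 1) * T / c) := by
    intro σ
    have h1 : (θ + n - 1) * (deficSum f σ - firstMoment f n / n) =
        deficMart θ f σ - (θ - 1) * (firstMoment f n / n) := by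
      rw [deficMart]; field_simp; ring
    have h2 : |firstMoment f n / n| ≤ T * n := by
      rw [abs_div, Nat.abs_cast, div_le_iff₀ hn0]
      exact (abs_firstMoment_le hf n).trans (le_of_eq (by ring))
    have h3 : |(θ - 1) * (firstMoment f n / n)| ≤ (θ + 1) * (T * n) := by
      rw [abs_mul]
      refine mul_le_mul ?_ h2 (abs_nonneg _) (by positivity)
      rw [abs_le]; constructor <;> linarith
    have h4 : c * n * |deficSum f σ - firstMoment f n / n| ≤
        |deficMart θ f σ| + (θ + 1) * (T * n) := by
      calc c * n * |deficSum f σ - firstMoment f n / n|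
          ≤ (θ + n - 1) * |deficSum f σ - firstMoment f n / n| :=
            mul_le_mul_of_nonneg_right hcn (abs_nonneg _)
        _ = |deficMart θ f σ - (θ - 1) * (firstMoment f n / n)| := by
            rw [← h1, abs_mul, abs_of_pos hpos]
        _ ≤ _ := (abs_sub _ _).trans (by linarith)
    have h5 : |deficMart θ f σ| ≤ (2 * r ^ 3)⁻¹ * deficMart θ f σ ^ 2 + r ^ 3 / 2 := by
      have : (0 : ℝ) ≤ (2 * r ^ 3)⁻¹ * (|deficMart θ f σ| - r ^ 3) ^ 2 := by positivity
      have h6 : (2 * r ^ 3)⁻¹ * (|deficMart θ f σ| - r ^ 3) ^ 2 =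
          (2 * r ^ 3)⁻¹ * |deficMart θ f σ| ^ 2 - |deficMart θ f σ| + r ^ 3 / 2 := by
        field_simp; ring
      rw [h6, sq_abs] at this
      linarith
    have h7 : |deficSum f σ - firstMoment f n / n| ≤
        ((2 * r ^ 3)⁻¹ * deficMart θ f σ ^ 2 + r ^ 3 / 2 + (θ + 1) * (T * n)) / (c * n) := by
      rw [le_div_iff₀ (by positivity), mul_comm]
      linarith
    refine h7.trans (le_of_eq ?_)
    rw [← hr2]
    field_simp
    ring
  refine (ewensAvg_mono hθ hpt).trans ?_
  rw [ewensAvg_add, ewensAvg_const_mul, ewensAvg_const hθ]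
  have h8 := mul_le_mul_of_nonneg_left (ewensAvg_deficMart_sq_le hf hθ n)
    (by positivity : 0 ≤ (2 * c * r ^ 5)⁻¹)
  have h9 : (2 * c * r ^ 5)⁻¹ * ((1 + 4 * θ) * T ^ 2 * n ^ 3) =
      (1 + 4 * θ) * T ^ 2 / (2 * c) * r := by
    rw [← hr2]; field_simp
  have h10 : (θ + 1) * T / c ≤ (θ + 1) * T / c * r :=
    le_mul_of_one_le_right (by positivity) hr1
  have h11 : devConst θ T * r = (1 + 4 * θ) * T ^ 2 / (2 * c) * r + r / (2 * c) +
      (θ + 1) * T / c * r + ((1 + 4 * θ) * T ^ 2 / (2 * c) * r + r / (2 * c)) := by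
    rw [devConst, ← hc]; field_simp; ring
  have h12 : 0 ≤ (1 + 4 * θ) * T ^ 2 / (2 * c) * r + r / (2 * c) := by positivity
  linarith

/-- The asymptotic mean of `condVar`. -/
def meanVar (f : ℕ → ℝ) (n : ℕ) : ℝ :=
  firstMoment (fun i => f i ^ 2) n - (firstMoment f n / n) ^ 2

theorem meanVar_nonneg (f : ℕ → ℝ) (n : ℕ) : 0 ≤ meanVar f n := by
  have h1 : firstMoment f n ^ 2 ≤
      (∑ i ∈ Finset.range n, (i : ℝ)) * firstMoment (fun i => f i ^ 2) n :=
    Finset.sum_sq_le_sum_mul_sum_of_sq_le_mul _ (fun i _ => Nat.cast_nonneg i)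
      (fun i _ => by positivity) (fun i _ => le_of_eq (by ring))
  have h2 : ∑ i ∈ Finset.range n, (i : ℝ) ≤ n ^ 2 := by
    simpa [firstMoment] using (le_abs_self _).trans
      (abs_firstMoment_le (f := fun _ => 1) (T := 1) (by simp) n)
  have h3 : 0 ≤ firstMoment (fun i => f i ^ 2) n :=
    Finset.sum_nonneg fun i _ => by positivity
  have h4 : (firstMoment f n / n) ^ 2 ≤ firstMoment (fun i => f i ^ 2) n := by
    rw [div_pow]
    refine div_le_of_le_mul₀ (by positivity) h3 ?_
    rw [mul_comm]
    exact h1.trans (mul_le_mul_of_nonneg_right h2 h3)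
  exact sub_nonneg.2 h4

theorem meanVar_le {f : ℕ → ℝ} {T : ℝ} (hf : ∀ i, |f i| ≤ T) (n : ℕ) :
    meanVar f n ≤ T ^ 2 * n ^ 2 := by
  have hf2 : ∀ i, |f i ^ 2| ≤ T ^ 2 := fun i => by
    rw [abs_pow]; exact pow_le_pow_left₀ (abs_nonneg _) (hf i) 2
  have := (le_abs_self _).trans (abs_firstMoment_le hf2 n)
  rw [meanVar]
  nlinarith [sq_nonneg (firstMoment f n / n)]

/-- The constant in the bound on the mean deviation of `condVar`. -/
def condVarConst (θ T : ℝ) : ℝ :=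
  devConst θ (T ^ 2) + 2 * T * devConst θ T + 4 * θ * T ^ 2

theorem devConst_nonneg {θ T : ℝ} (hθ : 0 < θ) (hT : 0 ≤ T) : 0 ≤ devConst θ T :=
  div_nonneg (by positivity) (le_min zero_le_one hθ.le)

theorem condVarConst_nonneg {θ T : ℝ} (hθ : 0 < θ) (hT : 0 ≤ T) : 0 ≤ condVarConst θ T := by
  have := devConst_nonneg hθ hT
  have := devConst_nonneg hθ (sq_nonneg T)
  rw [condVarConst]
  positivity

theorem ewensAvg_abs_condVar_sub_le {f : ℕ → ℝ} {T : ℝ} (hf : ∀ i, |f i| ≤ T) {θ : ℝ}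
    (hθ : 0 < θ) (n : ℕ) :
    ewensAvg θ n (fun σ => |condVar θ f σ - meanVar f n|) ≤ condVarConst θ T * (n * √n) := by
  have hT : 0 ≤ T := (abs_nonneg _).trans (hf 0)
  rcases Nat.eq_zero_or_pos n with rfl | hn
  · rw [ewensAvg_zero_fin]
    simp [condVar, meanVar, deficSum, firstMoment]
  have hn1 : (1 : ℝ) ≤ n := by exact_mod_cast hn
  have hn0 : (0 : ℝ) < n := by linarith
  have hf2 : ∀ i, |f i ^ 2| ≤ T ^ 2 := fun i => by
    rw [abs_pow]; exact pow_le_pow_left₀ (abs_nonneg _) (hf i) 2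
  have hpt : ∀ σ : Equiv.Perm (Fin n), |condVar θ f σ - meanVar f n| ≤
      n * |deficSum (fun i => f i ^ 2) σ - firstMoment (fun i => f i ^ 2) n / n| +
        2 * n * T * |deficSum f σ - firstMoment f n / n| + 4 * θ * n * T ^ 2 := by
    intro σ
    have h1 : condVar θ f σ - meanVar f n =
        n * (deficSum (fun i => f i ^ 2) σ - firstMoment (fun i => f i ^ 2) n / n) -
        (deficSum f σ + firstMoment f n / n) * (deficSum f σ - firstMoment f n / n) +
        θ * (n * f n ^ 2 - 2 * (f n * deficSum f σ) + deficSum (fun i => f i ^ 2) σ) := by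
      rw [condVar, meanVar]; field_simp; ring
    have hd := abs_deficSum_le hf σ
    have h2 : |firstMoment f n / n| ≤ n * T := by
      rw [abs_div, Nat.abs_cast, div_le_iff₀ hn0]
      exact (abs_firstMoment_le hf n).trans (le_of_eq (by ring))
    have h3 : |deficSum f σ + firstMoment f n / n| ≤ 2 * n * T :=
      (abs_add_le _ _).trans (by linarith)
    have h4 : |n * f n ^ 2 - 2 * (f n * deficSum f σ) + deficSum (fun i => f i ^ 2) σ|
        ≤ 4 * n * T ^ 2 := by
      have h5 : |f n * deficSum f σ| ≤ T * (n * T) := by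
        rw [abs_mul]
        exact mul_le_mul (hf n) hd (abs_nonneg _) hT
      have h6 : |(n : ℝ) * f n ^ 2| ≤ n * T ^ 2 := by
        rw [abs_mul, Nat.abs_cast]
        exact mul_le_mul_of_nonneg_left (hf2 n) hn0.le
      have h7 := abs_le.1 (abs_deficSum_le hf2 σ)
      have h5 := abs_le.1 h5
      have h6 := abs_le.1 h6
      rw [abs_le]
      constructor <;> linarith
    rw [h1]
    refine (abs_add_le _ _).trans (add_le_add ((abs_sub _ _).trans (add_le_add ?_ ?_)) ?_)
    · rw [abs_mul, Nat.abs_cast]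
    · rw [abs_mul]
      exact mul_le_mul_of_nonneg_right h3 (abs_nonneg _)
    · rw [abs_mul, abs_of_pos hθ]
      exact (mul_le_mul_of_nonneg_left h4 hθ.le).trans (le_of_eq (by ring))
  refine (ewensAvg_mono hθ hpt).trans ?_
  rw [ewensAvg_add, ewensAvg_add, ewensAvg_const_mul, ewensAvg_const_mul, ewensAvg_const hθ]
  have h1 := mul_le_mul_of_nonneg_left (ewensAvg_abs_deficSum_sub_le hf2 hθ hn) hn0.le
  have h2 := mul_le_mul_of_nonneg_left (ewensAvg_abs_deficSum_sub_le hf hθ hn)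
    (by positivity : 0 ≤ 2 * n * T)
  have h3 : 4 * θ * n * T ^ 2 ≤ 4 * θ * n * T ^ 2 * √n :=
    le_mul_of_one_le_right (by positivity) (Real.one_le_sqrt.2 hn1)
  rw [condVarConst]
  linarith

theorem norm_cexp_I_mul_sub_le {x : ℝ} (hx : |x| ≤ 1) :
    ‖Complex.exp (Complex.I * x) - (1 + Complex.I * x - (x : ℂ) ^ 2 / 2)‖ ≤ |x| ^ 3 := by
  have hn : ‖Complex.I * (x : ℂ)‖ = |x| := by simp
  have h := Complex.exp_bound (x := Complex.I * x) (by rw [hn]; exact hx) (n := 3) (by norm_num)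
  rw [hn] at h
  simp only [Finset.sum_range_succ, Finset.sum_range_zero, Nat.factorial] at h
  have h2 : (Complex.I * (x : ℂ)) ^ 2 = -(x : ℂ) ^ 2 := by
    rw [mul_pow, Complex.I_sq]; ring
  rw [h2] at h
  norm_num at h
  refine le_trans (le_of_eq ?_) (h.trans ?_)
  · congr 1; ring
  · have : 0 ≤ |x| ^ 3 := by positivity
    linarith

/-- Conditional characteristic function of the increment of `deficMart`. -/
def condChar (θ : ℝ) (f : ℕ → ℝ) (u : ℝ) {n : ℕ} (σ : Equiv.Perm (Fin n)) : ℂ :=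
  (θ + n)⁻¹ * (∑ j, Complex.exp (Complex.I * ↑(u * insertIncr θ f σ j)) +
    θ * Complex.exp (Complex.I * ↑(u * extendIncr f σ)))

theorem norm_condChar_sub_le {f : ℕ → ℝ} {T : ℝ} (hf : ∀ i, |f i| ≤ T) {θ : ℝ} (hθ : 0 < θ)
    {n : ℕ} {u : ℝ} (hu : 4 * T * (θ + n) * |u| ≤ 1) (σ : Equiv.Perm (Fin n)) :
    ‖condChar θ f u σ - (1 - ((u ^ 2 * condVar θ f σ / 2 : ℝ) : ℂ))‖ ≤ (4 * T * (θ + n) * |u|) ^ 3 := by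
  have hn : (0 : ℝ) < θ + n := by positivity
  have hnC : ((θ : ℂ) + n) ≠ 0 := by exact_mod_cast hn.ne'
  set g : ℝ → ℂ := fun x => Complex.exp (Complex.I * x) - (1 + Complex.I * x - (x : ℂ) ^ 2 / 2)
    with hg
  have hbd : ∀ d : ℝ, |d| ≤ 4 * T * (θ + n) → ‖g (u * d)‖ ≤ (4 * T * (θ + n) * |u|) ^ 3 := by
    intro d hd
    have h1 : |u * d| ≤ 4 * T * (θ + n) * |u| := by
      rw [abs_mul, mul_comm]
      exact mul_le_mul_of_nonneg_right hd (abs_nonneg u)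
    exact (norm_cexp_I_mul_sub_le (h1.trans hu)).trans (pow_le_pow_left₀ (abs_nonneg _) h1 3)
  have hexp : ∀ x : ℝ, Complex.exp (Complex.I * x) =
      g x + (1 + Complex.I * x - (x : ℂ) ^ 2 / 2) := fun x => by simp [hg]
  have hsum : (∑ j, (insertIncr θ f σ j : ℂ)) + θ * extendIncr f σ = 0 := by
    exact_mod_cast sum_insertIncr θ f σ
  have hsq : (∑ j, (insertIncr θ f σ j : ℂ) ^ 2) + θ * (extendIncr f σ : ℂ) ^ 2 =
      (θ + n) * condVar θ f σ := by
    exact_mod_cast sum_insertIncr_sq θ f σ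
  have hkey : condChar θ f u σ - (1 - ((u ^ 2 * condVar θ f σ / 2 : ℝ) : ℂ)) =
      ((θ + n)⁻¹ : ℝ) * (∑ j, g (u * insertIncr θ f σ j) + (θ : ℂ) * g (u * extendIncr f σ)) := by
    rw [condChar]
    simp only [hexp]
    push_cast
    simp only [mul_pow, Finset.sum_add_distrib, Finset.sum_sub_distrib, ← Finset.mul_sum,
      ← Finset.sum_div, Finset.sum_const, Finset.card_univ, Fintype.card_fin, nsmul_eq_mul, mul_one]
    field_simp
    linear_combination (2 * Complex.I * u) * hsum - (u : ℂ) ^ 2 * hsq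
  rw [hkey, norm_mul, Complex.norm_real, Real.norm_of_nonneg (by positivity),
    inv_mul_le_iff₀ hn]
  refine (norm_add_le _ _).trans ?_
  have h1 : ‖∑ j, g (u * insertIncr θ f σ j)‖ ≤ n * (4 * T * (θ + n) * |u|) ^ 3 := by
    refine (norm_sum_le _ _).trans ?_
    refine (Finset.sum_le_card_nsmul _ _ _ fun j _ => hbd _ (abs_insertIncr_le hf hθ σ j)).trans ?_
    simp
  have h2 : ‖(θ : ℂ) * g (u * extendIncr f σ)‖ ≤ θ * (4 * T * (θ + n) * |u|) ^ 3 := by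
    rw [norm_mul, Complex.norm_real, Real.norm_of_nonneg hθ.le]
    exact mul_le_mul_of_nonneg_left (hbd _ (abs_extendIncr_le hf hθ σ)) hθ.le
  linarith

/-- The asymptotic variance of `deficMart`. -/
def varSum (f : ℕ → ℝ) (n : ℕ) : ℝ := ∑ m ∈ Finset.range n, meanVar f m

theorem ewensAvg_cexp_succ {θ : ℝ} (hθ : 0 < θ) (f : ℕ → ℝ) (u : ℝ) (n : ℕ) :
    ewensAvg θ (n + 1) (fun σ => Complex.exp (Complex.I * ↑(u * deficMart θ f σ))) =
      ewensAvg θ n (fun σ => Complex.exp (Complex.I * ↑(u * deficMart θ f σ)) *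
        condChar θ f u σ) := by
  rw [ewensAvg_succ hθ]
  congr 1
  funext σ
  simp only [deficMart_insertLast, deficMart_extendLast, condChar, mul_add, Complex.ofReal_add,
    Complex.exp_add, ← Finset.mul_sum, Complex.real_smul]
  push_cast
  ring

theorem norm_ewensAvg_cexp_step {f : ℕ → ℝ} {T : ℝ} (hf : ∀ i, |f i| ≤ T) {θ : ℝ} (hθ : 0 < θ)
    {n : ℕ} {u : ℝ} (hu : 4 * T * (θ + n) * |u| ≤ 1) :
    ‖ewensAvg θ (n + 1) (fun σ => Complex.exp (Complex.I * ↑(u * deficMart θ f σ))) -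
        Complex.exp (-((u ^ 2 * meanVar f n / 2 : ℝ) : ℂ)) *
          ewensAvg θ n (fun σ => Complex.exp (Complex.I * ↑(u * deficMart θ f σ)))‖ ≤
      u ^ 2 * (condVarConst θ T * (n * √n)) + (u ^ 2 * (T ^ 2 * n ^ 2)) ^ 2 +
        (4 * T * (θ + n) * |u|) ^ 3 := by
  have hT : 0 ≤ T := (abs_nonneg _).trans (hf 0)
  have hδ0 := meanVar_nonneg f n
  have hδ := meanVar_le hf n
  set w : ℝ := u ^ 2 * meanVar f n / 2 with hw
  have hw0 : 0 ≤ w := by positivity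
  have hwle : w ≤ u ^ 2 * (T ^ 2 * n ^ 2) := by
    have := mul_le_mul_of_nonneg_left hδ (sq_nonneg u)
    have : 0 ≤ u ^ 2 * meanVar f n := by positivity
    rw [hw]; linarith
  have hw1 : w ≤ 1 := by
    refine hwle.trans ?_
    have h1 : T * n * |u| ≤ 1 := by
      refine le_trans ?_ hu
      refine mul_le_mul_of_nonneg_right ?_ (abs_nonneg u)
      have : 0 ≤ T * θ := by positivity
      have : 0 ≤ T * n := by positivity
      nlinarith
    have h2 : u ^ 2 * (T ^ 2 * n ^ 2) = (T * n * |u|) ^ 2 := by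
      rw [mul_pow, mul_pow, sq_abs]; ring
    rw [h2]
    exact pow_le_one₀ (by positivity) h1
  have hexpw : ‖Complex.exp (-(w : ℂ)) - (1 - w)‖ ≤ (u ^ 2 * (T ^ 2 * n ^ 2)) ^ 2 := by
    have h := Complex.norm_exp_sub_one_sub_id_le (x := -(w : ℂ)) (by
      rw [norm_neg, Complex.norm_real, Real.norm_of_nonneg hw0]; exact hw1)
    rw [norm_neg, Complex.norm_real, Real.norm_of_nonneg hw0] at h
    refine le_trans (le_of_eq ?_) (h.trans (pow_le_pow_left₀ hw0 hwle 2))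
    congr 1; ring
  rw [ewensAvg_cexp_succ hθ, ← ewensAvg_const_mul, ← ewensAvg_sub]
  refine (norm_ewensAvg_le hθ _).trans ?_
  have hpt : ∀ σ : Equiv.Perm (Fin n),
      ‖Complex.exp (Complex.I * ↑(u * deficMart θ f σ)) * condChar θ f u σ -
        Complex.exp (-(w : ℂ)) * Complex.exp (Complex.I * ↑(u * deficMart θ f σ))‖ ≤
      u ^ 2 * |condVar θ f σ - meanVar f n| +
        ((u ^ 2 * (T ^ 2 * n ^ 2)) ^ 2 + (4 * T * (θ + n) * |u|) ^ 3) := by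
    intro σ
    rw [mul_comm (Complex.exp (-(w : ℂ))), ← mul_sub, norm_mul, Complex.norm_exp_I_mul_ofReal,
      one_mul]
    have h1 := norm_condChar_sub_le hf hθ hu σ
    have h2 : condChar θ f u σ - Complex.exp (-(w : ℂ)) =
        (condChar θ f u σ - (1 - ((u ^ 2 * condVar θ f σ / 2 : ℝ) : ℂ))) -
        (Complex.exp (-(w : ℂ)) - (1 - w)) -
        ((u ^ 2 * (condVar θ f σ - meanVar f n) / 2 : ℝ) : ℂ) := by
      rw [hw]; push_cast; ring
    have h3 : ‖((u ^ 2 * (condVar θ f σ - meanVar f n) / 2 : ℝ) : ℂ)‖ ≤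
        u ^ 2 * |condVar θ f σ - meanVar f n| := by
      rw [Complex.norm_real, Real.norm_eq_abs, abs_div, abs_mul, abs_of_nonneg (sq_nonneg u), abs_two]
      exact half_le_self (by positivity)
    rw [h2]
    refine (norm_sub_le _ _).trans ((add_le_add (norm_sub_le _ _) le_rfl).trans ?_)
    linarith
  refine (ewensAvg_mono hθ hpt).trans ?_
  rw [ewensAvg_add, ewensAvg_const_mul, ewensAvg_const hθ]
  have := mul_le_mul_of_nonneg_left (ewensAvg_abs_condVar_sub_le hf hθ n) (sq_nonneg u)
  linarith

theorem norm_ewensAvg_cexp_sub_le {f : ℕ → ℝ} {T : ℝ} (hf : ∀ i, |f i| ≤ T) {θ : ℝ} (hθ : 0 < θ)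
    {N : ℕ} {u : ℝ} (hu : 4 * T * (θ + N) * |u| ≤ 1) :
    ‖ewensAvg θ N (fun σ => Complex.exp (Complex.I * ↑(u * deficMart θ f σ))) -
        Complex.exp (-((u ^ 2 * varSum f N / 2 : ℝ) : ℂ))‖ ≤
      N * (u ^ 2 * (condVarConst θ T * (N * √N)) + (u ^ 2 * (T ^ 2 * N ^ 2)) ^ 2 +
        (4 * T * (θ + N) * |u|) ^ 3) := by
  have hT : 0 ≤ T := (abs_nonneg _).trans (hf 0)
  have hK := condVarConst_nonneg hθ hT
  set ε : ℝ := u ^ 2 * (condVarConst θ T * (N * √N)) + (u ^ 2 * (T ^ 2 * N ^ 2)) ^ 2 +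
        (4 * T * (θ + N) * |u|) ^ 3 with hε
  suffices h : ∀ n : ℕ, n ≤ N →
      ‖ewensAvg θ n (fun σ => Complex.exp (Complex.I * ↑(u * deficMart θ f σ))) -
        Complex.exp (-((u ^ 2 * varSum f n / 2 : ℝ) : ℂ))‖ ≤ n * ε from h N le_rfl
  intro n
  induction n with
  | zero =>
    intro _
    rw [ewensAvg_zero_fin]
    simp [deficMart, deficSum, firstMoment, varSum]
  | succ n ih =>
    intro hn
    have ih := ih (Nat.le_of_succ_le hn)
    have hnN : (n : ℝ) ≤ N := by exact_mod_cast Nat.le_of_succ_le hn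
    have hmono : 4 * T * (θ + n) * |u| ≤ 4 * T * (θ + N) * |u| := by gcongr
    have hstep := norm_ewensAvg_cexp_step hf hθ (hmono.trans hu)
    have hle : u ^ 2 * (condVarConst θ T * (n * √n)) + (u ^ 2 * (T ^ 2 * n ^ 2)) ^ 2 +
        (4 * T * (θ + n) * |u|) ^ 3 ≤ ε := by
      rw [hε]; gcongr
    have hexp : Complex.exp (-((u ^ 2 * varSum f (n + 1) / 2 : ℝ) : ℂ)) =
        Complex.exp (-((u ^ 2 * meanVar f n / 2 : ℝ) : ℂ)) * Complex.exp (-((u ^ 2 * varSum f n / 2 : ℝ) : ℂ)) := by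
      rw [← Complex.exp_add, varSum, Finset.sum_range_succ, ← varSum]
      congr 1; push_cast; ring
    have hnorm : ‖Complex.exp (-((u ^ 2 * meanVar f n / 2 : ℝ) : ℂ))‖ ≤ 1 := by
      rw [← Complex.ofReal_neg, Complex.norm_exp_ofReal, Real.exp_le_one_iff, neg_nonpos]
      have := meanVar_nonneg f n
      positivity
    rw [hexp]
    have h1 := norm_sub_le_norm_sub_add_norm_sub
      (ewensAvg θ (n + 1) (fun σ => Complex.exp (Complex.I * ↑(u * deficMart θ f σ))))
      (Complex.exp (-((u ^ 2 * meanVar f n / 2 : ℝ) : ℂ)) *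
          ewensAvg θ n (fun σ => Complex.exp (Complex.I * ↑(u * deficMart θ f σ))))
      (Complex.exp (-((u ^ 2 * meanVar f n / 2 : ℝ) : ℂ)) * Complex.exp (-((u ^ 2 * varSum f n / 2 : ℝ) : ℂ)))
    rw [← mul_sub, norm_mul] at h1
    have h2 := mul_le_of_le_one_left (norm_nonneg
      (ewensAvg θ n (fun σ => Complex.exp (Complex.I * ↑(u * deficMart θ f σ))) -
        Complex.exp (-((u ^ 2 * varSum f n / 2 : ℝ) : ℂ)))) hnorm
    rw [Nat.cast_succ]
    linarith

/-- The piecewise affine interpolation weight of the index `i` for the partial sum up to `y`. -/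
def ramp (y : ℝ) (i : ℕ) : ℝ := min 1 (max 0 (y - i))

theorem ramp_nonneg (y : ℝ) (i : ℕ) : 0 ≤ ramp y i := le_min zero_le_one (le_max_left _ _)

theorem ramp_le_one (y : ℝ) (i : ℕ) : ramp y i ≤ 1 := min_le_left _ _

theorem ramp_of_le {y : ℝ} {i : ℕ} (h : y ≤ i) : ramp y i = 0 := by
  rw [ramp, max_eq_left (by linarith), min_eq_right zero_le_one]

theorem ramp_of_add_one_le {y : ℝ} {i : ℕ} (h : (i : ℝ) + 1 ≤ y) : ramp y i = 1 := by
  rw [ramp, max_eq_right (by linarith), min_eq_left (by linarith)]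

theorem ramp_of_mem {y : ℝ} {i : ℕ} (h : (i : ℝ) ≤ y) (h' : y ≤ i + 1) : ramp y i = y - i := by
  rw [ramp, max_eq_right (by linarith), min_eq_right (by linarith)]

theorem abs_firstMoment_ramp_sub_le {x : ℝ} (hx : 0 ≤ x) (m : ℕ) :
    |firstMoment (ramp x) m - min x (m : ℝ) ^ 2 / 2| ≤ (m : ℝ) := by
  have h : firstMoment (ramp x) m ≤ min x m ^ 2 / 2 ∧
      min x m ^ 2 / 2 ≤ firstMoment (ramp x) m + m / 2 := by
    induction m with
    | zero => simp [firstMoment, hx]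
    | succ m ih =>
      rw [firstMoment, Finset.sum_range_succ, ← firstMoment]
      push_cast
      rcases le_total x m with h1 | h1
      · rw [ramp_of_le h1, min_eq_left (by linarith)]
        rw [min_eq_left h1] at ih
        constructor <;> linarith
      rw [min_eq_right h1] at ih
      rcases le_total x (m + 1) with h2 | h2
      · rw [ramp_of_mem h1 h2, min_eq_left h2]
        constructor <;> nlinarith
      · rw [ramp_of_add_one_le h2, min_eq_right h2]
        constructor <;> nlinarith
  have : (0 : ℝ) ≤ m := Nat.cast_nonneg m
  rw [abs_le]
  constructor <;> linarith [h.1, h.2]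

theorem abs_firstMoment_ramp_mul_ramp_sub_le {x y : ℝ} (hx : 0 ≤ x) (hxy : x ≤ y) (m : ℕ) :
    |firstMoment (fun i => ramp x i * ramp y i) m - min x (m : ℝ) ^ 2 / 2| ≤ 2 * (m : ℝ) := by
  have h1 : |firstMoment (ramp x) m - firstMoment (fun i => ramp x i * ramp y i) m| ≤ m := by
    rw [firstMoment, firstMoment, ← Finset.sum_sub_distrib]
    have hterm : ∀ i : ℕ, 0 ≤ (i : ℝ) * ramp x i - i * (ramp x i * ramp y i) ∧
        (i : ℝ) * ramp x i - i * (ramp x i * ramp y i) ≤ if i = ⌊y⌋₊ then (i : ℝ) else 0 := by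
      intro i
      have hx0 := ramp_nonneg x i
      have hx1 := ramp_le_one x i
      have hy0 := ramp_nonneg y i
      have hy1 := ramp_le_one y i
      have he : (i : ℝ) * ramp x i - i * (ramp x i * ramp y i) =
          i * (ramp x i * (1 - ramp y i)) := by ring
      rw [he]
      refine ⟨mul_nonneg (Nat.cast_nonneg i) (mul_nonneg hx0 (by linarith)), ?_⟩
      split_ifs with hi
      · exact mul_le_of_le_one_right (Nat.cast_nonneg i)
          (mul_le_one₀ hx1 (by linarith) (by linarith))
      · rcases le_or_gt x i with h | h
        · simp [ramp_of_le h]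
        · have hiy : (i : ℝ) + 1 ≤ y := by
            have h2 : i ≤ ⌊y⌋₊ := Nat.le_floor (by linarith)
            have h3 : i + 1 ≤ ⌊y⌋₊ := by omega
            exact_mod_cast (Nat.le_floor_iff (by linarith)).1 h3
          simp [ramp_of_add_one_le hiy]
    rw [abs_of_nonneg (Finset.sum_nonneg fun i _ => (hterm i).1)]
    refine (Finset.sum_le_sum fun i _ => (hterm i).2).trans ?_
    rw [Finset.sum_ite_eq']
    split_ifs with h
    · exact_mod_cast (Finset.mem_range.1 h).le
    · exact Nat.cast_nonneg m
  have h2 := abs_firstMoment_ramp_sub_le hx m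
  rw [abs_le] at *
  constructor <;> linarith [h1.1, h1.2, h2.1, h2.2]

/-- The asymptotic covariance of two increments, before summation over the insertion times. -/
def pairVar (f g : ℕ → ℝ) (m : ℕ) : ℝ :=
  firstMoment (fun i => f i * g i) m - firstMoment f m * firstMoment g m / m ^ 2

/-- The scaling limit of `pairVar` for the weights `ramp`. -/
def pairLim (x y s : ℝ) : ℝ :=
  min (min x y) s ^ 2 / 2 - min x s ^ 2 * min y s ^ 2 / (4 * s ^ 2)

theorem pairVar_comm (f g : ℕ → ℝ) (m : ℕ) : pairVar f g m = pairVar g f m := by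
  simp only [pairVar, mul_comm]

theorem pairLim_comm (x y s : ℝ) : pairLim x y s = pairLim y x s := by
  rw [pairLim, pairLim, min_comm x y, mul_comm (min x s ^ 2)]

theorem pairLim_mul {a : ℝ} (ha : 0 < a) (x y s : ℝ) :
    pairLim (a * x) (a * y) (a * s) = a ^ 2 * pairLim x y s := by
  have h : ∀ u v : ℝ, min (a * u) (a * v) = a * min u v := fun u v =>
    (mul_min_of_nonneg u v ha.le).symm
  simp only [pairLim, h, mul_pow]
  rcases eq_or_ne s 0 with rfl | hs
  · simp; ring
  · field_simp

theorem abs_pairVar_sub_le {x y : ℝ} (hx : 0 ≤ x) (hy : 0 ≤ y) (m : ℕ) :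
    |pairVar (ramp x) (ramp y) m - pairLim x y m| ≤ 4 * (m : ℝ) := by
  wlog hxy : x ≤ y generalizing x y
  · rw [pairVar_comm, pairLim_comm]
    exact this hy hx (le_of_not_ge hxy)
  rcases Nat.eq_zero_or_pos m with rfl | hm
  · simp [pairVar, pairLim, firstMoment, hx, hxy]
  have hm0 : (0 : ℝ) < m := by exact_mod_cast hm
  have h1 := abs_firstMoment_ramp_mul_ramp_sub_le hx hxy m
  have h2 := abs_firstMoment_ramp_sub_le hx m
  have h3 := abs_firstMoment_ramp_sub_le hy m
  have h4 : |firstMoment (ramp x) m| ≤ 1 * m ^ 2 := abs_firstMoment_le (fun i => by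
    rw [abs_of_nonneg (ramp_nonneg x i)]; exact ramp_le_one x i) m
  have h5 : |min y (m : ℝ) ^ 2 / 2| ≤ (m : ℝ) ^ 2 := by
    rw [abs_of_nonneg (by positivity)]
    have : min y (m : ℝ) ^ 2 ≤ m ^ 2 := pow_le_pow_left₀ (le_min hy hm0.le) (min_le_right _ _) 2
    linarith [sq_nonneg (m : ℝ)]
  have h6 : |firstMoment (ramp x) m * firstMoment (ramp y) m / (m : ℝ) ^ 2 -
      min x m ^ 2 * min y m ^ 2 / (4 * m ^ 2)| ≤ 2 * (m : ℝ) := by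
    have he : firstMoment (ramp x) m * firstMoment (ramp y) m / m ^ 2 -
        min x m ^ 2 * min y m ^ 2 / (4 * m ^ 2) =
        (firstMoment (ramp x) m * (firstMoment (ramp y) m - min y m ^ 2 / 2) +
          (min y m ^ 2 / 2) * (firstMoment (ramp x) m - min x m ^ 2 / 2)) / m ^ 2 := by
      field_simp; ring
    rw [he, abs_div, abs_of_pos (by positivity : (0 : ℝ) < m ^ 2), div_le_iff₀ (by positivity)]
    refine (abs_add_le _ _).trans ?_
    rw [abs_mul, abs_mul]
    have h7 := mul_le_mul h4 h3 (abs_nonneg _) (by positivity)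
    have h8 := mul_le_mul h5 h2 (abs_nonneg _) (by positivity)
    linarith
  rw [pairVar, pairLim, min_eq_left hxy]
  rw [abs_le] at h1 h6 ⊢
  constructor <;> linarith [h1.1, h1.2, h6.1, h6.2]

theorem integral_comp_nat_floor (g : ℝ → ℝ) {N : ℕ} (hN : 1 ≤ N) :
    ∫ s in (0 : ℝ)..1, g (⌊s * N⌋₊ / N) = (∑ m ∈ Finset.range N, g (m / N)) / N := by
  have hN0 : (N : ℝ) ≠ 0 := by positivity
  have hfl : ∀ m : ℕ, Set.EqOn (fun _ : ℝ => g (m / N)) (fun v : ℝ => g (⌊v⌋₊ / N))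
      (Set.Ioo (m : ℝ) (m + 1 : ℕ)) := by
    intro m v hv
    have : ⌊v⌋₊ = m := (Nat.floor_eq_iff ((Nat.cast_nonneg m).trans hv.1.le)).2
      ⟨hv.1.le, by simpa using hv.2⟩
    simp [this]
  have hm : ∀ m : ℕ, (m : ℝ) ≤ (m + 1 : ℕ) := fun m => by simp
  have hsum := intervalIntegral.sum_integral_adjacent_intervals (f := fun v : ℝ => g (⌊v⌋₊ / N))
    (μ := MeasureTheory.volume) (a := fun m : ℕ => (m : ℝ)) (n := N) (fun m _ =>
      (intervalIntegrable_const (c := g (m / N))).congr_uIoo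
        (by rw [Set.uIoo_of_le (hm m)]; exact hfl m))
  have hcell : ∀ m : ℕ, ∫ v in (m : ℝ)..(m + 1 : ℕ), g (⌊v⌋₊ / N) = g (m / N) := by
    intro m
    rw [← intervalIntegral.integral_congr_Ioo_of_le (hm m) (hfl m)]
    simp
  rw [intervalIntegral.integral_comp_mul_right (fun v => g (⌊v⌋₊ / N)) hN0]
  simp only [hcell] at hsum
  rw [hsum]
  simp [div_eq_inv_mul]

theorem tendsto_sum_div_integral {g : ℝ → ℝ} (hg : Measurable g)
    (hc : ∀ s, 0 < s → ContinuousAt g s) {C : ℝ} (hb : ∀ s ∈ Set.Icc (0 : ℝ) 1, |g s| ≤ C) :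
    Filter.Tendsto (fun N : ℕ => (∑ m ∈ Finset.range N, g (m / N)) / N) Filter.atTop
      (nhds (∫ s in (0 : ℝ)..1, g s)) := by
  have h : Filter.Tendsto (fun N : ℕ => ∫ s in (0 : ℝ)..1, g (⌊s * N⌋₊ / N)) Filter.atTop
      (nhds (∫ s in (0 : ℝ)..1, g s)) := by
    refine intervalIntegral.tendsto_integral_filter_of_dominated_convergence (fun _ => C) ?_ ?_
      intervalIntegrable_const ?_
    · refine Filter.Eventually.of_forall fun N => Measurable.aestronglyMeasurable ?_
      fun_prop
    · filter_upwards [Filter.eventually_ge_atTop 1] with N hN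
      refine MeasureTheory.ae_of_all _ fun s hs => ?_
      rw [Set.uIoc_of_le zero_le_one] at hs
      have hN0 : (0 : ℝ) < N := by positivity
      refine hb _ ⟨by positivity, ?_⟩
      rw [div_le_one hN0]
      exact (Nat.floor_le (mul_nonneg hs.1.le hN0.le)).trans (mul_le_of_le_one_left hN0.le hs.2)
    · refine MeasureTheory.ae_of_all _ fun s hs => ?_
      rw [Set.uIoc_of_le zero_le_one] at hs
      exact (hc s hs.1).tendsto.comp
        ((tendsto_nat_floor_mul_div_atTop hs.1.le).comp tendsto_natCast_atTop_atTop)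
  refine h.congr' ?_
  filter_upwards [Filter.eventually_ge_atTop 1] with N hN
  exact integral_comp_nat_floor g hN

theorem integral_min_mul_one_sub_max {t y : ℝ} (ht : 0 ≤ t) (hty : t ≤ y) :
    ∫ u in (0 : ℝ)..y, min t u * (1 - max t u) = t * (y - y ^ 2 / 2) - t ^ 2 / 2 := by
  have hc : Continuous fun u : ℝ => min t u * (1 - max t u) := by fun_prop
  have h1 : ∫ u in (0 : ℝ)..t, min t u * (1 - max t u) = ∫ u in (0 : ℝ)..t, u * (1 - t) := by
    refine intervalIntegral.integral_congr fun u hu => ?_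
    rw [Set.uIcc_of_le ht] at hu
    simp only [min_eq_right hu.2, max_eq_left hu.2]
  have h2 : ∫ u in t..y, min t u * (1 - max t u) = ∫ u in t..y, t * (1 - u) := by
    refine intervalIntegral.integral_congr fun u hu => ?_
    rw [Set.uIcc_of_le hty] at hu
    simp only [min_eq_left hu.1, max_eq_right hu.1]
  rw [← intervalIntegral.integral_add_adjacent_intervals (hc.intervalIntegrable 0 t)
    (hc.intervalIntegrable t y), h1, h2, intervalIntegral.integral_mul_const,
    intervalIntegral.integral_const_mul, intervalIntegral.integral_sub (by simp) (by simp)]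
  simp
  ring

theorem integral_min_mul_one_sub_max_of_le {t y : ℝ} (hy : 0 ≤ y) (hty : y ≤ t) :
    ∫ u in (0 : ℝ)..y, min t u * (1 - max t u) = (1 - t) * (y ^ 2 / 2) := by
  have h1 : ∫ u in (0 : ℝ)..y, min t u * (1 - max t u) = ∫ u in (0 : ℝ)..y, u * (1 - t) := by
    refine intervalIntegral.integral_congr fun u hu => ?_
    rw [Set.uIcc_of_le hy] at hu
    simp only [min_eq_right (hu.2.trans hty), max_eq_left (hu.2.trans hty)]
  rw [h1, intervalIntegral.integral_mul_const]
  simp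
  ring

theorem Kcov_of_le {x y : ℝ} (hx : 0 ≤ x) (hxy : x ≤ y) :
    Kcov x y = x ^ 2 / 2 - x ^ 3 / 6 - x ^ 2 * y / 2 + x ^ 2 * y ^ 2 / 4 := by
  have h1 : ∫ t in (0 : ℝ)..x, ∫ u in (0 : ℝ)..y, min t u * (1 - max t u) =
      ∫ t in (0 : ℝ)..x, (t * (y - y ^ 2 / 2) - t ^ 2 / 2) := by
    refine intervalIntegral.integral_congr fun t ht => ?_
    rw [Set.uIcc_of_le hx] at ht
    exact integral_min_mul_one_sub_max ht.1 (ht.2.trans hxy)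
  have h2 : ∫ t in (0 : ℝ)..x, t * (1 - t) = ∫ t in (0 : ℝ)..x, (t - t ^ 2) :=
    intervalIntegral.integral_congr fun t _ => by ring
  have hi : ∀ a b c : ℝ, IntervalIntegrable (fun t : ℝ => t * c) MeasureTheory.volume a b :=
    fun a b c => Continuous.intervalIntegrable (by fun_prop) a b
  have hj : ∀ a b : ℝ, IntervalIntegrable (fun t : ℝ => t ^ 2) MeasureTheory.volume a b :=
    fun a b => Continuous.intervalIntegrable (by fun_prop) a b
  rw [Kcov, min_eq_left hxy, h1, h2, intervalIntegral.integral_sub (by simp) (hj _ _),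
    intervalIntegral.integral_sub (hi _ _ _) ((hj _ _).div_const 2),
    intervalIntegral.integral_mul_const, intervalIntegral.integral_div, integral_id, integral_pow]
  norm_num
  ring

theorem Kcov_of_ge {x y : ℝ} (hy : 0 ≤ y) (hyx : y ≤ x) :
    Kcov x y = y ^ 2 / 2 - y ^ 3 / 6 - y ^ 2 * x / 2 + y ^ 2 * x ^ 2 / 4 := by
  have h1 : ∫ t in (0 : ℝ)..y, ∫ u in (0 : ℝ)..y, min t u * (1 - max t u) =
      ∫ t in (0 : ℝ)..y, (t * (y - y ^ 2 / 2) - t ^ 2 / 2) := by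
    refine intervalIntegral.integral_congr fun t ht => ?_
    rw [Set.uIcc_of_le hy] at ht
    exact integral_min_mul_one_sub_max ht.1 ht.2
  have h3 : ∫ t in y..x, ∫ u in (0 : ℝ)..y, min t u * (1 - max t u) =
      ∫ t in y..x, (1 - t) * (y ^ 2 / 2) := by
    refine intervalIntegral.integral_congr fun t ht => ?_
    rw [Set.uIcc_of_le hyx] at ht
    exact integral_min_mul_one_sub_max_of_le hy ht.1
  have h2 : ∫ t in (0 : ℝ)..y, t * (1 - t) = ∫ t in (0 : ℝ)..y, (t - t ^ 2) :=
    intervalIntegral.integral_congr fun t _ => by ring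
  have hi : ∀ a b c : ℝ, IntervalIntegrable (fun t : ℝ => t * c) MeasureTheory.volume a b :=
    fun a b c => Continuous.intervalIntegrable (by fun_prop) a b
  have hj : ∀ a b : ℝ, IntervalIntegrable (fun t : ℝ => t ^ 2) MeasureTheory.volume a b :=
    fun a b => Continuous.intervalIntegrable (by fun_prop) a b
  have hc : Continuous fun t : ℝ => ∫ u in (0 : ℝ)..y, min t u * (1 - max t u) :=
    intervalIntegral.continuous_parametric_intervalIntegral_of_continuous' (by fun_prop) 0 y
  rw [Kcov, min_eq_right hyx, ← intervalIntegral.integral_add_adjacent_intervals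
    (hc.intervalIntegrable 0 y) (hc.intervalIntegrable y x), h1, h2, h3,
    intervalIntegral.integral_sub (by simp) (hj _ _),
    intervalIntegral.integral_sub (hi _ _ _) ((hj _ _).div_const 2),
    intervalIntegral.integral_mul_const, intervalIntegral.integral_mul_const,
    intervalIntegral.integral_sub (by simp) (by simp),
    intervalIntegral.integral_div, integral_id, integral_id, integral_pow]
  norm_num
  ring

theorem Kcov_comm {x y : ℝ} (hx : 0 ≤ x) (hy : 0 ≤ y) : Kcov x y = Kcov y x := by
  rcases le_total x y with h | h
  · rw [Kcov_of_le hx h, Kcov_of_ge hx h]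
  · rw [Kcov_of_ge hy h, Kcov_of_le hy h]

theorem measurable_pairLim (x y : ℝ) : Measurable (pairLim x y) := by
  unfold pairLim; fun_prop

theorem continuousAt_pairLim (x y : ℝ) {s : ℝ} (hs : 0 < s) : ContinuousAt (pairLim x y) s := by
  unfold pairLim
  refine ContinuousAt.sub (by fun_prop) (ContinuousAt.div (by fun_prop) (by fun_prop) ?_)
  positivity

theorem abs_pairLim_le {x y s : ℝ} (hx : 0 ≤ x) (hy : 0 ≤ y) (hs : s ∈ Set.Icc (0 : ℝ) 1) :
    |pairLim x y s| ≤ 1 := by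
  rcases hs.1.eq_or_lt with h0 | h0
  · simp [pairLim, ← h0, hx, hy]
  have hx2 : min x s ^ 2 ≤ s ^ 2 := pow_le_pow_left₀ (le_min hx h0.le) (min_le_right _ _) 2
  have hy2 : min y s ^ 2 ≤ s ^ 2 := pow_le_pow_left₀ (le_min hy h0.le) (min_le_right _ _) 2
  have hxy2 : min (min x y) s ^ 2 ≤ s ^ 2 :=
    pow_le_pow_left₀ (le_min (le_min hx hy) h0.le) (min_le_right _ _) 2
  have hs2 : s ^ 2 ≤ 1 := pow_le_one₀ h0.le hs.2
  have h1 : min x s ^ 2 * min y s ^ 2 / (4 * s ^ 2) ≤ 1 := by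
    rw [div_le_one (by positivity)]
    have := mul_le_mul hx2 hy2 (sq_nonneg _) (sq_nonneg _)
    nlinarith [sq_nonneg s]
  have h2 : 0 ≤ min x s ^ 2 * min y s ^ 2 / (4 * s ^ 2) := by positivity
  rw [pairLim, abs_le]
  constructor <;> linarith [sq_nonneg (min (min x y) s)]

theorem integral_pairLim {x y : ℝ} (hx : 0 ≤ x) (hxy : x ≤ y) (hy1 : y ≤ 1) :
    ∫ s in (0 : ℝ)..1, pairLim x y s = Kcov x y := by
  rw [Kcov_of_le hx hxy]
  rcases hx.eq_or_lt with rfl | hx0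
  · rw [intervalIntegral.integral_congr (g := fun _ => 0)]
    · simp
    · intro s hs
      rw [Set.uIcc_of_le zero_le_one] at hs
      simp [pairLim, hxy, hs.1]
  have hy0 : 0 < y := hx0.trans_le hxy
  have hd1 : ∀ s ∈ Set.Icc 0 x, pairLim x y s = s ^ 2 / 4 := by
    intro s hs
    rw [pairLim, min_eq_left hxy, min_eq_right hs.2, min_eq_right (hs.2.trans hxy)]
    rcases eq_or_ne s 0 with rfl | h
    · simp
    · field_simp; ring
  have hd2 : ∀ s ∈ Set.Icc x y, pairLim x y s = x ^ 2 / 4 := by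
    intro s hs
    have : 0 < s := hx0.trans_le hs.1
    rw [pairLim, min_eq_left hxy, min_eq_left hs.1, min_eq_right hs.2]
    field_simp; ring
  have hd3 : ∀ s ∈ Set.Icc y 1, pairLim x y s = x ^ 2 / 2 - x ^ 2 * y ^ 2 / 4 / s ^ 2 := by
    intro s hs
    have : 0 < s := hy0.trans_le hs.1
    rw [pairLim, min_eq_left hxy, min_eq_left (hxy.trans hs.1), min_eq_left hs.1]
    field_simp
  have hH3 : ∀ s ∈ Set.uIcc y 1, HasDerivAt (fun s => x ^ 2 / 2 * s + x ^ 2 * y ^ 2 / 4 * s⁻¹)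
      (pairLim x y s) s := by
    intro s hs
    rw [Set.uIcc_of_le hy1] at hs
    have : s ≠ 0 := (hy0.trans_le hs.1).ne'
    rw [hd3 s hs]
    exact (((hasDerivAt_id s).const_mul (x ^ 2 / 2)).add
      ((hasDerivAt_inv this).const_mul (x ^ 2 * y ^ 2 / 4))).congr_deriv (by field_simp; ring)
  have hi : ∀ a b : ℝ, 0 ≤ a → a ≤ b → b ≤ 1 →
      IntervalIntegrable (pairLim x y) MeasureTheory.volume a b := by
    intro a b ha hab hb
    refine (intervalIntegrable_const (c := (1 : ℝ))).mono_fun'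
      (measurable_pairLim x y).aestronglyMeasurable ?_
    rw [Set.uIoc_of_le hab]
    refine MeasureTheory.ae_restrict_of_forall_mem measurableSet_Ioc fun s hs => ?_
    exact abs_pairLim_le hx hy0.le ⟨ha.trans hs.1.le, hs.2.trans hb⟩
  have hI1 : ∫ s in (0 : ℝ)..x, pairLim x y s = ∫ s in (0 : ℝ)..x, s ^ 2 / 4 :=
    intervalIntegral.integral_congr (by rw [Set.uIcc_of_le hx]; exact hd1)
  have hI2 : ∫ s in x..y, pairLim x y s = ∫ s in x..y, x ^ 2 / 4 :=
    intervalIntegral.integral_congr (by rw [Set.uIcc_of_le hxy]; exact hd2)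
  rw [← intervalIntegral.integral_add_adjacent_intervals (hi 0 y le_rfl hy0.le hy1)
    (hi y 1 hy0.le hy1 le_rfl),
    ← intervalIntegral.integral_add_adjacent_intervals (hi 0 x le_rfl hx (hxy.trans hy1))
    (hi x y hx hxy hy1),
    intervalIntegral.integral_eq_sub_of_hasDerivAt hH3 (hi y 1 hy0.le hy1 le_rfl), hI1, hI2,
    intervalIntegral.integral_div, integral_pow, intervalIntegral.integral_const]
  simp only [smul_eq_mul]
  field_simp
  norm_num
  ring

theorem tendsto_sum_pairVar {x y : ℝ} (hx : x ∈ Set.Icc (0 : ℝ) 1) (hy : y ∈ Set.Icc (0 : ℝ) 1) :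
    Filter.Tendsto (fun N : ℕ => (∑ m ∈ Finset.range N,
      pairVar (ramp (N * x)) (ramp (N * y)) m) / (N : ℝ) ^ 3) Filter.atTop (nhds (Kcov x y)) := by
  wlog hxy : x ≤ y generalizing x y
  · simp only [pairVar_comm (ramp (_ * x))]
    rw [Kcov_comm hx.1 hy.1]
    exact this hy hx (le_of_not_ge hxy)
  have h := tendsto_sum_div_integral (measurable_pairLim x y)
    (fun s hs => continuousAt_pairLim x y hs) (fun s hs => abs_pairLim_le hx.1 hy.1 hs)
  rw [integral_pairLim hx.1 hxy hy.2] at h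
  refine h.congr_dist ?_
  refine squeeze_zero' (Filter.Eventually.of_forall fun _ => dist_nonneg) ?_
    (tendsto_const_div_atTop_nhds_zero_nat 4)
  filter_upwards [Filter.eventually_ge_atTop 1] with N hN
  have hN0 : (0 : ℝ) < N := by positivity
  have he : (∑ m ∈ Finset.range N, pairLim x y (m / N)) / (N : ℝ) =
      (∑ m ∈ Finset.range N, pairLim (N * x) (N * y) m) / (N : ℝ) ^ 3 := by
    have : ∀ m : ℕ, pairLim (N * x) (N * y) m = (N : ℝ) ^ 2 * pairLim x y (m / N) := by
      intro m
      rw [← pairLim_mul hN0, mul_div_cancel₀ _ hN0.ne']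
    simp only [this, ← Finset.mul_sum]
    field_simp
  rw [he, dist_comm, Real.dist_eq, ← sub_div, ← Finset.sum_sub_distrib, abs_div,
    abs_of_pos (by positivity : (0 : ℝ) < N ^ 3), div_le_div_iff₀ (by positivity) hN0]
  have hs : |∑ m ∈ Finset.range N, (pairVar (ramp (N * x)) (ramp (N * y)) m -
      pairLim (N * x) (N * y) m)| ≤ 4 * (N : ℝ) ^ 2 := by
    refine (Finset.abs_sum_le_sum_abs _ _).trans ?_
    refine (Finset.sum_le_card_nsmul _ _ (4 * (N : ℝ)) fun m hm => ?_).trans ?_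
    · have : (m : ℝ) ≤ N := by exact_mod_cast (Finset.mem_range.1 hm).le
      exact (abs_pairVar_sub_le (by have := hx.1; positivity) (by have := hy.1; positivity) m).trans
        (by linarith)
    · simp only [Finset.card_range, nsmul_eq_mul]
      exact le_of_eq (by ring)
  have := mul_le_mul_of_nonneg_right hs hN0.le
  linarith

theorem countExc_eq_sum {N : ℕ} (σ : Equiv.Perm (Fin N)) (k : ℕ) :
    (countExc σ k : ℝ) = ∑ i : Fin N, if (i : ℕ) < k ∧ i ≤ σ i then (1 : ℝ) else 0 := by
  simp [countExc, Finset.sum_boole]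

theorem mul_Fex {N : ℕ} (hN : 1 ≤ N) (σ : Equiv.Perm (Fin N)) {x : ℝ} (hx : 0 ≤ x) :
    N * Fex σ x = ∑ i : Fin N, ramp (N * x) i - deficSum (ramp (N * x)) σ := by
  have hN0 : (N : ℝ) ≠ 0 := by positivity
  rw [Fex, mul_div_cancel₀ _ hN0, countExc_eq_sum, countExc_eq_sum, ← Finset.sum_sub_distrib,
    Finset.mul_sum, ← Finset.sum_add_distrib, deficSum, ← Finset.sum_sub_distrib]
  refine Finset.sum_congr rfl fun i _ => ?_
  have hy : 0 ≤ (N : ℝ) * x := by positivity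
  set y := (N : ℝ) * x
  have h1 := Nat.floor_le hy
  have h2 := Nat.lt_floor_add_one y
  rcases lt_or_ge (σ i) i with hi | hi
  · simp [hi, hi.not_ge]
  simp only [hi, and_true, hi.not_gt, if_false, sub_zero]
  rcases lt_trichotomy (i : ℕ) ⌊y⌋₊ with h | h | h
  · have h3 : ((i : ℕ) : ℝ) + 1 ≤ (⌊y⌋₊ : ℝ) := by exact_mod_cast h
    simp [h, h.trans (Nat.lt_succ_self _), ramp_of_add_one_le (h3.trans h1)]
  · rw [ramp_of_mem (by rw [h]; exact h1) (by rw [h]; exact h2.le), h]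
    simp
  · have h3 : (⌊y⌋₊ : ℝ) + 1 ≤ ((i : ℕ) : ℝ) := by exact_mod_cast h
    have h4 : ¬ (i : ℕ) < ⌊y⌋₊ + 1 := by omega
    rw [if_neg h.not_gt, if_neg h4, ramp_of_le (h2.le.trans h3)]
    simp

/-- The linear combination of the weights `ramp` with coefficients `t`. -/
def rampSum {r : ℕ} (x t : Fin r → ℝ) (N i : ℕ) : ℝ := ∑ j, t j * ramp (N * x j) i

theorem abs_rampSum_le {r : ℕ} (x t : Fin r → ℝ) (N i : ℕ) :
    |rampSum x t N i| ≤ ∑ j, |t j| := by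
  refine (Finset.abs_sum_le_sum_abs _ _).trans (Finset.sum_le_sum fun j _ => ?_)
  rw [abs_mul, abs_of_nonneg (ramp_nonneg _ i)]
  exact mul_le_of_le_one_right (abs_nonneg _) (ramp_le_one _ i)

theorem deficSum_rampSum {r : ℕ} (x t : Fin r → ℝ) (N : ℕ) {n : ℕ} (σ : Equiv.Perm (Fin n)) :
    deficSum (rampSum x t N) σ = ∑ j, t j * deficSum (ramp (N * x j)) σ := by
  simp only [deficSum, rampSum, Finset.mul_sum]
  rw [Finset.sum_comm]
  refine Finset.sum_congr rfl fun i _ => ?_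
  split_ifs <;> simp

theorem firstMoment_rampSum {r : ℕ} (x t : Fin r → ℝ) (N m : ℕ) :
    firstMoment (rampSum x t N) m = ∑ j, t j * firstMoment (ramp (N * x j)) m := by
  simp only [firstMoment, rampSum, Finset.mul_sum]
  rw [Finset.sum_comm]
  exact Finset.sum_congr rfl fun j _ => Finset.sum_congr rfl fun i _ => by ring

theorem firstMoment_rampSum_sq {r : ℕ} (x t : Fin r → ℝ) (N m : ℕ) :
    firstMoment (fun i => rampSum x t N i ^ 2) m =
      ∑ j, ∑ l, t j * t l * firstMoment (fun i => ramp (N * x j) i * ramp (N * x l) i) m := by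
  simp only [firstMoment, rampSum, sq, Finset.sum_mul_sum]
  simp only [Finset.mul_sum]
  rw [Finset.sum_comm]
  refine Finset.sum_congr rfl fun j _ => ?_
  rw [Finset.sum_comm]
  exact Finset.sum_congr rfl fun l _ => Finset.sum_congr rfl fun i _ => by ring

theorem varSum_rampSum {r : ℕ} (x t : Fin r → ℝ) (N : ℕ) :
    varSum (rampSum x t N) N = ∑ j, ∑ l, t j * t l *
      ∑ m ∈ Finset.range N, pairVar (ramp (N * x j)) (ramp (N * x l)) m := by
  have h : ∀ m, meanVar (rampSum x t N) m =
      ∑ j, ∑ l, t j * t l * pairVar (ramp (N * x j)) (ramp (N * x l)) m := by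
    intro m
    simp only [meanVar, pairVar, mul_sub, Finset.sum_sub_distrib]
    rw [firstMoment_rampSum_sq, firstMoment_rampSum, div_pow, sq (∑ j, _), Finset.sum_mul_sum,
      Finset.sum_div]
    simp only [Finset.sum_div]
    congr 1
    exact Finset.sum_congr rfl fun j _ => Finset.sum_congr rfl fun l _ => by ring
  simp only [varSum, h, Finset.mul_sum]
  rw [Finset.sum_comm]
  exact Finset.sum_congr rfl fun j _ => Finset.sum_comm

/-- The quadratic form of the limiting covariance. -/
def covForm {r : ℕ} (x t : Fin r → ℝ) : ℝ := ∑ j, ∑ l, t j * t l * Kcov (x j) (x l)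

theorem tendsto_varSum_rampSum {r : ℕ} {x : Fin r → ℝ} (hx : ∀ j, x j ∈ Set.Icc (0 : ℝ) 1)
    (t : Fin r → ℝ) :
    Filter.Tendsto (fun N : ℕ => varSum (rampSum x t N) N / (N : ℝ) ^ 3) Filter.atTop
      (nhds (covForm x t)) := by
  have h : ∀ N : ℕ, varSum (rampSum x t N) N / (N : ℝ) ^ 3 = ∑ j, ∑ l, t j * t l *
      ((∑ m ∈ Finset.range N, pairVar (ramp (N * x j)) (ramp (N * x l)) m) / (N : ℝ) ^ 3) := by
    intro N
    rw [varSum_rampSum, Finset.sum_div]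
    refine Finset.sum_congr rfl fun j _ => ?_
    rw [Finset.sum_div]
    exact Finset.sum_congr rfl fun l _ => mul_div_assoc _ _ _
  simp only [h]
  exact tendsto_finsetSum _ fun j _ => tendsto_finsetSum _ fun l _ =>
    (tendsto_sum_pairVar (hx j) (hx l)).const_mul _

theorem covForm_nonneg {r : ℕ} {x : Fin r → ℝ} (hx : ∀ j, x j ∈ Set.Icc (0 : ℝ) 1)
    (t : Fin r → ℝ) : 0 ≤ covForm x t :=
  ge_of_tendsto' (tendsto_varSum_rampSum hx t) fun N =>
    div_nonneg (Finset.sum_nonneg fun m _ => meanVar_nonneg _ m) (by positivity)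

/-- The rescaled fluctuations of `Fex` at the points `x`. -/
def fluct (θ : ℝ) {r : ℕ} (x : Fin r → ℝ) (N : ℕ) (σ : Equiv.Perm (Fin N)) (j : Fin r) : ℝ :=
  √N * (Fex σ (x j) - ewensE θ N (fun τ => Fex τ (x j)))

theorem sum_mul_fluct {θ : ℝ} (hθ : 0 < θ) {r : ℕ} {x : Fin r → ℝ}
    (hx : ∀ j, x j ∈ Set.Icc (0 : ℝ) 1) (t : Fin r → ℝ) {N : ℕ} (hN : 1 ≤ N)
    (σ : Equiv.Perm (Fin N)) :
    ∑ j, t j * fluct θ x N σ j = -((θ + N - 1) * √N)⁻¹ * deficMart θ (rampSum x t N) σ := by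
  have hN1 : (1 : ℝ) ≤ N := by exact_mod_cast hN
  have hN0 : (0 : ℝ) < N := by linarith
  have hD : 0 < θ + N - 1 := by linarith
  have hs : 0 < √(N : ℝ) := Real.sqrt_pos.2 hN0
  have hss : √(N : ℝ) ^ 2 = N := Real.sq_sqrt hN0.le
  have hF : ∀ (τ : Equiv.Perm (Fin N)) j, Fex τ (x j) =
      (∑ i : Fin N, ramp (N * x j) i) / N -
        ((N : ℝ) * (θ + N - 1))⁻¹ * (deficMart θ (ramp (N * x j)) τ +
          firstMoment (ramp (N * x j)) N) := by
    intro τ j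
    have := mul_Fex hN τ (hx j).1
    rw [deficMart]
    field_simp
    linear_combination (θ + N - 1) * this
  have hj : ∀ j, fluct θ x N σ j =
      -((θ + N - 1) * √N)⁻¹ * deficMart θ (ramp (N * x j)) σ := by
    intro j
    have hE : ewensE θ N (fun τ => Fex τ (x j)) = (∑ i : Fin N, ramp (N * x j) i) / N -
        ((N : ℝ) * (θ + N - 1))⁻¹ * firstMoment (ramp (N * x j)) N := by
      simp only [hF]
      rw [ewensE_eq_ewensAvg, ewensAvg_sub, ewensAvg_const hθ, ewensAvg_const_mul, ewensAvg_add,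
        ewensAvg_const hθ, ewensAvg_deficMart hθ, zero_add]
    rw [fluct, hE, hF σ j]
    have h1 : ((N : ℝ) * (θ + N - 1))⁻¹ * √N = ((θ + N - 1) * √N)⁻¹ := by
      rw [mul_inv, mul_inv, mul_assoc, mul_comm, mul_assoc]
      congr 1
      nth_rw 2 [← hss]
      field_simp
    rw [← h1]
    ring
  simp only [hj, deficMart, deficSum_rampSum, firstMoment_rampSum, Finset.mul_sum,
    ← Finset.sum_sub_distrib]
  exact Finset.sum_congr rfl fun j _ => by ring

theorem tendsto_ewensAvg_cexp_fluct {θ : ℝ} (hθ : 0 < θ) {r : ℕ} {x : Fin r → ℝ}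
    (hx : ∀ j, x j ∈ Set.Icc (0 : ℝ) 1) (t : Fin r → ℝ) :
    Filter.Tendsto (fun N : ℕ => ewensAvg θ N
      (fun σ => Complex.exp (Complex.I * ↑(∑ j, t j * fluct θ x N σ j)))) Filter.atTop
      (nhds (Complex.exp (-((covForm x t / 2 : ℝ) : ℂ)))) := by
  set T : ℝ := ∑ j, |t j| with hT
  have hT0 : 0 ≤ T := Finset.sum_nonneg fun j _ => abs_nonneg _
  set u : ℕ → ℝ := fun N => -((θ + N - 1) * √N)⁻¹ with hu
  set C := condVarConst θ T
  have hC : 0 ≤ C := condVarConst_nonneg hθ hT0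
  set A : ℝ := 8 * T * (1 + θ) with hA
  have hA0 : 0 ≤ A := by positivity
  have hsq : Filter.Tendsto (fun N : ℕ => (√N)⁻¹) Filter.atTop (nhds (0 : ℝ)) :=
    tendsto_inv_atTop_zero.comp (Real.tendsto_sqrt_atTop.comp tendsto_natCast_atTop_atTop)
  have hvar : Filter.Tendsto (fun N : ℕ => u N ^ 2 * varSum (rampSum x t N) N) Filter.atTop
      (nhds (covForm x t)) := by
    have h1 : Filter.Tendsto (fun N : ℕ => (1 + (θ - 1) / (N : ℝ))⁻¹ ^ 2) Filter.atTop
        (nhds 1) := by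
      have := (((tendsto_const_div_atTop_nhds_zero_nat (θ - 1)).const_add 1).inv₀
        (by norm_num)).pow 2
      simpa using this
    have h2 := h1.mul (tendsto_varSum_rampSum hx t)
    rw [one_mul] at h2
    refine h2.congr' ?_
    filter_upwards [Filter.eventually_ge_atTop 1] with N hN
    have hN1 : (1 : ℝ) ≤ N := by exact_mod_cast hN
    have hD : 0 < θ + N - 1 := by linarith
    have hs : √(N : ℝ) ^ 2 = N := Real.sq_sqrt (by linarith)
    have h3 : 1 + (θ - 1) / (N : ℝ) = (θ + N - 1) / N := by field_simp; ring
    simp only [hu]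
    rw [h3, neg_sq, inv_pow ((θ + N - 1) * √N), mul_pow, hs]
    field_simp
  have hmain : Filter.Tendsto (fun N : ℕ => Complex.exp
      (-((u N ^ 2 * varSum (rampSum x t N) N / 2 : ℝ) : ℂ))) Filter.atTop
      (nhds (Complex.exp (-((covForm x t / 2 : ℝ) : ℂ)))) := by
    refine (Complex.continuous_exp.comp (Complex.continuous_ofReal.neg)).continuousAt.tendsto.comp ?_
    exact hvar.div_const 2
  have herr : Filter.Tendsto (fun N : ℕ => (4 * C + 16 * T ^ 4 + A ^ 3) * (√N)⁻¹) Filter.atTop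
      (nhds 0) := by
    simpa using hsq.const_mul (4 * C + 16 * T ^ 4 + A ^ 3)
  refine hmain.congr_dist (squeeze_zero' (Filter.Eventually.of_forall fun _ => dist_nonneg) ?_ herr)
  have hsmall : ∀ᶠ N : ℕ in Filter.atTop, A * (√N)⁻¹ ≤ 1 := by
    have := hsq.const_mul A
    rw [mul_zero] at this
    exact this.eventually_le_const one_pos
  filter_upwards [Filter.eventually_ge_atTop 2, hsmall] with N hN hAN
  have hN2 : (2 : ℝ) ≤ N := by exact_mod_cast hN
  have hN0 : (0 : ℝ) < N := by linarith
  set q : ℝ := √N with hq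
  have hq0 : 0 < q := Real.sqrt_pos.2 hN0
  have hq1 : 1 ≤ q := Real.one_le_sqrt.2 (by linarith)
  have hqN : (N : ℝ) = q ^ 2 := (Real.sq_sqrt hN0.le).symm
  have hD : 0 < θ + N - 1 := by linarith
  have hub : |u N| ≤ 2 / q ^ 3 := by
    simp only [hu]
    rw [abs_neg, abs_of_pos (by positivity), inv_eq_one_div, div_le_div_iff₀ (by positivity)
      (by positivity)]
    have : q ^ 2 ≤ 2 * (θ + N - 1) := by rw [← hqN]; linarith
    nlinarith
  have hu2 : u N ^ 2 ≤ 4 / q ^ 6 := by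
    rw [← sq_abs]
    refine (pow_le_pow_left₀ (abs_nonneg _) hub 2).trans (le_of_eq ?_)
    field_simp; norm_num
  have hinc : 4 * T * (θ + N) * |u N| ≤ A * q⁻¹ := by
    have h1 : θ + N ≤ (1 + θ) * q ^ 2 := by rw [← hqN]; nlinarith
    calc 4 * T * (θ + N) * |u N| ≤ 4 * T * ((1 + θ) * q ^ 2) * (2 / q ^ 3) := by gcongr
      _ = A * q⁻¹ := by rw [hA]; field_simp; ring
  have h := norm_ewensAvg_cexp_sub_le (abs_rampSum_le x t N) hθ (hinc.trans hAN)
  simp only [sum_mul_fluct hθ hx t (by omega : 1 ≤ N)]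
  rw [dist_comm, dist_eq_norm]
  refine h.trans ?_
  have hqinv : q⁻¹ ≤ 1 := inv_le_one_of_one_le₀ hq1
  calc (N : ℝ) * (u N ^ 2 * (C * (N * q)) + (u N ^ 2 * (T ^ 2 * N ^ 2)) ^ 2 +
        (4 * T * (θ + N) * |u N|) ^ 3)
      ≤ q ^ 2 * (4 / q ^ 6 * (C * (q ^ 2 * q)) + (4 / q ^ 6 * (T ^ 2 * (q ^ 2) ^ 2)) ^ 2 +
        (A * q⁻¹) ^ 3) := by
        rw [← hqN]
        gcongr
    _ = 4 * C * q⁻¹ + 16 * T ^ 4 * (q⁻¹ * q⁻¹) + A ^ 3 * q⁻¹ := by field_simp; ring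
    _ ≤ 4 * C * q⁻¹ + 16 * T ^ 4 * (q⁻¹ * 1) + A ^ 3 * q⁻¹ := by gcongr
    _ = _ := by ring

/-- The law of the fluctuations `fluct` as a measure on the Euclidean space. -/
def fluctLaw (θ : ℝ) {r : ℕ} (x : Fin r → ℝ) (N : ℕ) :
    MeasureTheory.Measure (EuclideanSpace ℝ (Fin r)) :=
  ∑ σ : Equiv.Perm (Fin N), ENNReal.ofReal (ewensWeight θ σ) •
    MeasureTheory.Measure.dirac (WithLp.toLp 2 (fluct θ x N σ))

theorem integral_fluctLaw {θ : ℝ} (hθ : 0 < θ) {r : ℕ} (x : Fin r → ℝ) (N : ℕ)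
    {E : Type*} [NormedAddCommGroup E] [NormedSpace ℝ E] [CompleteSpace E]
    (f : EuclideanSpace ℝ (Fin r) → E) :
    ∫ y, f y ∂fluctLaw θ x N =
      ∑ σ : Equiv.Perm (Fin N), ewensWeight θ σ • f (WithLp.toLp 2 (fluct θ x N σ)) := by
  rw [fluctLaw, MeasureTheory.integral_finsetSum_measure]
  · refine Finset.sum_congr rfl fun σ _ => ?_
    rw [MeasureTheory.integral_smul_measure, MeasureTheory.integral_dirac,
      ENNReal.toReal_ofReal (ewensWeight_nonneg hθ σ)]
  · intro σ _
    exact (MeasureTheory.integrable_dirac enorm_lt_top).smul_measure ENNReal.ofReal_ne_top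

theorem isProbabilityMeasure_fluctLaw {θ : ℝ} (hθ : 0 < θ) {r : ℕ} (x : Fin r → ℝ) (N : ℕ) :
    MeasureTheory.IsProbabilityMeasure (fluctLaw θ x N) := by
  constructor
  simp only [fluctLaw, MeasureTheory.Measure.coe_finsetSum, Finset.sum_apply,
    MeasureTheory.Measure.smul_apply, MeasureTheory.measure_univ, smul_eq_mul, mul_one]
  rw [← ENNReal.ofReal_sum_of_nonneg fun σ _ => ewensWeight_nonneg hθ σ, sum_ewensWeight hθ,
    ENNReal.ofReal_one]

/-- The limiting covariance matrix. -/
def covMatrix {r : ℕ} (x : Fin r → ℝ) : Matrix (Fin r) (Fin r) ℝ :=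
  Matrix.of fun j l => Kcov (x j) (x l)

theorem dotProduct_covMatrix {r : ℕ} (x t : Fin r → ℝ) :
    t ⬝ᵥ (covMatrix x).mulVec t = covForm x t := by
  simp only [dotProduct, Matrix.mulVec, covMatrix, Matrix.of_apply, covForm, Finset.mul_sum]
  exact Finset.sum_congr rfl fun j _ => Finset.sum_congr rfl fun l _ => by ring

theorem posSemidef_covMatrix {r : ℕ} {x : Fin r → ℝ} (hx : ∀ j, x j ∈ Set.Icc (0 : ℝ) 1) :
    (covMatrix x).PosSemidef := by
  refine Matrix.posSemidef_iff_dotProduct_mulVec.2 ⟨?_, fun t => ?_⟩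
  · ext j l
    simpa [covMatrix] using Kcov_comm (hx l).1 (hx j).1
  · rw [star_trivial, dotProduct_covMatrix]
    exact covForm_nonneg hx t

theorem charFun_multivariateGaussian_covMatrix {r : ℕ} {x : Fin r → ℝ}
    (hx : ∀ j, x j ∈ Set.Icc (0 : ℝ) 1) (t : EuclideanSpace ℝ (Fin r)) :
    MeasureTheory.charFun (ProbabilityTheory.multivariateGaussian 0 (covMatrix x)) t =
      Complex.exp (-((covForm x t.ofLp / 2 : ℝ) : ℂ)) := by
  rw [ProbabilityTheory.charFun_multivariateGaussian (posSemidef_covMatrix hx),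
    dotProduct_covMatrix]
  simp

theorem charFun_fluctLaw {θ : ℝ} (hθ : 0 < θ) {r : ℕ} (x : Fin r → ℝ) (N : ℕ)
    (t : EuclideanSpace ℝ (Fin r)) :
    MeasureTheory.charFun (fluctLaw θ x N) t = ewensAvg θ N
      (fun σ => Complex.exp (Complex.I * ↑(∑ j, t j * fluct θ x N σ j))) := by
  rw [MeasureTheory.charFun_apply, integral_fluctLaw hθ, ewensAvg]
  refine Finset.sum_congr rfl fun σ _ => ?_
  rw [mul_comm Complex.I]
  simp [PiLp.inner_apply]

theorem tendsto_integral_fluctLaw {θ : ℝ} (hθ : 0 < θ) {r : ℕ} {x : Fin r → ℝ}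
    (hx : ∀ j, x j ∈ Set.Icc (0 : ℝ) 1)
    (f : BoundedContinuousFunction (EuclideanSpace ℝ (Fin r)) ℝ) :
    Filter.Tendsto (fun N => ∫ y, f y ∂fluctLaw θ x N) Filter.atTop
      (nhds (∫ y, f y ∂ProbabilityTheory.multivariateGaussian 0 (covMatrix x))) := by
  let μ : ℕ → MeasureTheory.ProbabilityMeasure (EuclideanSpace ℝ (Fin r)) :=
    fun N => ⟨fluctLaw θ x N, isProbabilityMeasure_fluctLaw hθ x N⟩
  let μ₀ : MeasureTheory.ProbabilityMeasure (EuclideanSpace ℝ (Fin r)) :=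
    ⟨ProbabilityTheory.multivariateGaussian 0 (covMatrix x), inferInstance⟩
  have h : Filter.Tendsto μ Filter.atTop (nhds μ₀) := by
    refine MeasureTheory.ProbabilityMeasure.tendsto_of_tendsto_charFun fun t => ?_
    simp only [μ, μ₀, MeasureTheory.ProbabilityMeasure.coe_mk, charFun_fluctLaw hθ,
      charFun_multivariateGaussian_covMatrix hx]
    exact tendsto_ewensAvg_cexp_fluct hθ hx t.ofLp
  exact MeasureTheory.ProbabilityMeasure.tendsto_iff_forall_integral_tendsto.1 h f

theorem map_multivariateGaussian_covMatrix {r : ℕ} {x : Fin r → ℝ}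
    (hx : ∀ j, x j ∈ Set.Icc (0 : ℝ) 1) (t : Fin r → ℝ) :
    (ProbabilityTheory.multivariateGaussian 0 (covMatrix x)).map
      (fun y : EuclideanSpace ℝ (Fin r) => ∑ j, t j * y j) =
      ProbabilityTheory.gaussianReal 0 (Real.toNNReal (covForm x t)) := by
  have hmeas : Measurable (fun y : EuclideanSpace ℝ (Fin r) => ∑ j, t j * y j) := by fun_prop
  have := MeasureTheory.Measure.isProbabilityMeasure_map
    (μ := ProbabilityTheory.multivariateGaussian 0 (covMatrix x)) hmeas.aemeasurable
  refine MeasureTheory.Measure.ext_of_charFun (funext fun s => ?_)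
  have h := charFun_multivariateGaussian_covMatrix hx (WithLp.toLp 2 (s • t))
  have hq : covForm x (s • t) = s ^ 2 * covForm x t := by
    simp only [covForm, Pi.smul_apply, smul_eq_mul, Finset.mul_sum]
    exact Finset.sum_congr rfl fun j _ => Finset.sum_congr rfl fun l _ => by ring
  rw [MeasureTheory.charFun_apply, hq] at h
  rw [MeasureTheory.charFun_apply_real, ProbabilityTheory.charFun_gaussianReal,
    MeasureTheory.integral_map hmeas.aemeasurable (by fun_prop),
    Real.coe_toNNReal _ (covForm_nonneg hx t)]
  convert h using 1
  · refine MeasureTheory.integral_congr_ae (Filter.Eventually.of_forall fun y => ?_)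
    simp [PiLp.inner_apply, Finset.mul_sum, mul_assoc]
  · congr 1
    push_cast
    ring

/-- Theorem 1.2, second part: the rescaled fluctuations
`Z^{(N)}(x) = √N (F^{(N)}_{σ_N}(x) − E F^{(N)}_{σ_N}(x))` at points `x_1,…,x_r` converge in
distribution to a centered Gaussian vector with covariance matrix `(K(x_i,x_j))`.
The limiting law `G` is characterized as the probability measure on `Fin r → ℝ` all of whose
one-dimensional linear projections are the appropriate centered real Gaussians. -/
theorem Fex_fluctuations_gaussian (θ : ℝ) (hθ : 0 < θ) (r : ℕ) (x : Fin r → ℝ)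
    (hx : ∀ j, x j ∈ Set.Icc (0 : ℝ) 1) :
    ∃ G : MeasureTheory.Measure (Fin r → ℝ), MeasureTheory.IsProbabilityMeasure G ∧
      (∀ t : Fin r → ℝ,
        G.map (fun y => ∑ j, t j * y j) =
          ProbabilityTheory.gaussianReal 0
            (Real.toNNReal (∑ j, ∑ l, t j * t l * Kcov (x j) (x l)))) ∧
      (∀ f : BoundedContinuousFunction (Fin r → ℝ) ℝ,
        Filter.Tendsto
          (fun N => ewensE θ N (fun σ =>
            f (fun j => Real.sqrt N *
              (Fex σ (x j) - ewensE θ N (fun σ' => Fex σ' (x j))))))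
          Filter.atTop (nhds (∫ y, f y ∂G))) := by
  have hm : Measurable (WithLp.ofLp : EuclideanSpace ℝ (Fin r) → Fin r → ℝ) := by fun_prop
  have hc : Continuous (WithLp.ofLp : EuclideanSpace ℝ (Fin r) → Fin r → ℝ) := by fun_prop
  refine ⟨(ProbabilityTheory.multivariateGaussian 0 (covMatrix x)).map WithLp.ofLp,
    MeasureTheory.Measure.isProbabilityMeasure_map hm.aemeasurable, fun t => ?_, fun f => ?_⟩
  · rw [MeasureTheory.Measure.map_map (by fun_prop) hm]
    exact map_multivariateGaussian_covMatrix hx t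
  · rw [MeasureTheory.integral_map hm.aemeasurable
      f.continuous.measurable.aestronglyMeasurable]
    refine (tendsto_integral_fluctLaw hθ hx (f.compContinuous ⟨_, hc⟩)).congr fun N => ?_
    rw [integral_fluctLaw hθ, ewensE_eq_ewensAvg]
    rfl

end
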